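/- Let 0 < ε < 1/384 and let f encode a smooth embedded paper Moebius band of aspect ratio λ with λ < √3 + ε, with image Ω = f '' (ℝ × [0,1]). Then there exist points A, B, C ∈ ℝ³ with pairwise distances 2√3/3 such that every point of Ω is within distance 6√ε of the equilateral triangle ▽₀ = convexHull ℝ {A, B, C}, and every point of ▽₀ is within distance 18√ε of Ω. -/

import Mathlib

namespace PaperMoebius

open Set Filter Topology
open scoped ContDiff RealInnerProductSpace

section DirectionalDerivative

variable {V : Type*} [NormedAddCommGroup V] [NormedSpace ℝ V]

/-- The derivative of `G` in the constant direction `v`, as a function of the base point. -/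
noncomputable def dirD (v : ℝ × ℝ) (G : ℝ × ℝ → V) : ℝ × ℝ → V := fun p => fderiv ℝ G p v

variable {G H : ℝ × ℝ → V}

lemma contDiff_dirD (hG : ContDiff ℝ ∞ G) (v : ℝ × ℝ) : ContDiff ℝ ∞ (dirD v G) :=
  (hG.fderiv_right (m := ∞) (by simp)).clm_apply contDiff_const

lemma differentiable_of_smooth (hG : ContDiff ℝ ∞ G) : Differentiable ℝ G :=
  hG.differentiable (by simp)

lemma dirD_comm (hG : ContDiff ℝ ∞ G) (v w : ℝ × ℝ) :
    dirD v (dirD w G) = dirD w (dirD v G) := by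
  have key : ∀ (a b : ℝ × ℝ) (p), dirD a (dirD b G) p = fderiv ℝ (fderiv ℝ G) p a b := by
    intro a b p
    have h1 : DifferentiableAt ℝ (fderiv ℝ G) p :=
      ((hG.fderiv_right (m := ∞) (by simp)).differentiable (by simp)) p
    have h2 := (h1.hasFDerivAt.clm_apply (hasFDerivAt_const b p)).fderiv
    unfold dirD
    rw [h2]
    simp
  funext p
  rw [key, key]
  exact (hG.contDiffAt.isSymmSndFDerivAt (by
    rw [minSmoothness_of_isRCLikeNormedField]; exact WithTop.coe_le_coe.2 (le_top : (2 : ℕ∞) ≤ ⊤))) v w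

lemma hasDerivAt_line (hG : ContDiff ℝ ∞ G) (p v : ℝ × ℝ) (s : ℝ) :
    HasDerivAt (fun s : ℝ => G (p + s • v)) (dirD v G (p + s • v)) s := by
  have h1 : HasDerivAt (fun s : ℝ => p + s • v) v s := by
    simpa using ((hasDerivAt_id s).smul_const v).const_add p
  exact ((differentiable_of_smooth hG) (p + s • v)).hasFDerivAt.comp_hasDerivAt s h1

lemma dirD_congr {O : Set (ℝ × ℝ)} (hO : IsOpen O) (h : EqOn G H O) (v : ℝ × ℝ) :
    EqOn (dirD v G) (dirD v H) O := by
  intro p hp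
  have : G =ᶠ[𝓝 p] H := h.eventuallyEq_of_mem (hO.mem_nhds hp)
  simp [dirD, this.fderiv_eq]

lemma dirD_lin (G : ℝ × ℝ → V) (v w : ℝ × ℝ) (a b : ℝ) (p : ℝ × ℝ) :
    dirD (a • v + b • w) G p = a • dirD v G p + b • dirD w G p := by
  simp [dirD]

lemma dirD_const_lin (hG : ContDiff ℝ ∞ G) (hH : ContDiff ℝ ∞ H) (v : ℝ × ℝ) (a b : ℝ) :
    dirD v (fun p => a • G p + b • H p) = fun p => a • dirD v G p + b • dirD v H p := by
  funext p
  have h1 := ((differentiable_of_smooth hG p).hasFDerivAt.const_smul a).add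
    ((differentiable_of_smooth hH p).hasFDerivAt.const_smul b)
  have h2 := h1.fderiv
  simp only [dirD]
  erw [h2]
  simp

end DirectionalDerivative

lemma dirD_mul {G H : ℝ × ℝ → ℝ} (hG : ContDiff ℝ ∞ G) (hH : ContDiff ℝ ∞ H) (v : ℝ × ℝ) :
    dirD v (fun p => G p * H p) = fun p => dirD v G p * H p + G p * dirD v H p := by
  funext p
  have h1 := (differentiable_of_smooth hG p).hasFDerivAt.mul
    (differentiable_of_smooth hH p).hasFDerivAt
  simp only [dirD]
  erw [h1.fderiv]
  simp
  ring

lemma dirD_inner {E : Type*} [NormedAddCommGroup E] [InnerProductSpace ℝ E]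
    {G H : ℝ × ℝ → E} (hG : ContDiff ℝ ∞ G) (hH : ContDiff ℝ ∞ H) (v : ℝ × ℝ) :
    dirD v (fun p => ⟪G p, H p⟫) = fun p => ⟪dirD v G p, H p⟫ + ⟪G p, dirD v H p⟫ := by
  funext p
  simp only [dirD]
  rw [fderiv_inner_apply ℝ (differentiable_of_smooth hG p) (differentiable_of_smooth hH p)]
  ring

lemma dirD_inner_const {E : Type*} [NormedAddCommGroup E] [InnerProductSpace ℝ E]
    {G : ℝ × ℝ → E} (hG : ContDiff ℝ ∞ G) (e : E) (v : ℝ × ℝ) :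
    dirD v (fun p => ⟪G p, e⟫) = fun p => ⟪dirD v G p, e⟫ := by
  rw [dirD_inner hG contDiff_const]
  funext p
  simp [dirD]

/-- The Hessian determinant relation, expressed with two directions `n`, `v`. -/
def HessDegenerateOn (h : ℝ × ℝ → ℝ) (n v : ℝ × ℝ) (O : Set (ℝ × ℝ)) : Prop :=
  ∀ q ∈ O, dirD n (dirD n h) q * dirD v (dirD v h) q = dirD n (dirD v h) q ^ 2

section Ruling

variable {h : ℝ × ℝ → ℝ} {n v p : ℝ × ℝ} {O : Set (ℝ × ℝ)} {b : ℝ}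

lemma mixed_eq_zero (hh : ContDiff ℝ ∞ h) (hO : IsOpen O)
    (hb : ∀ s ∈ Icc (0 : ℝ) b, p + s • v ∈ O) (hdet : HessDegenerateOn h n v O)
    (hL : ∀ s ∈ Icc (0 : ℝ) b, dirD n (dirD n h) (p + s • v) ≠ 0)
    (hM : dirD n (dirD v h) p = 0) :
    ∀ s ∈ Icc (0 : ℝ) b, dirD n (dirD v h) (p + s • v) = 0 := by
  have cn := contDiff_dirD hh n
  have cv := contDiff_dirD hh v
  have cL := contDiff_dirD cn n
  have cM := contDiff_dirD cv n
  have cP := contDiff_dirD cv v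
  have hline : Continuous fun s : ℝ => p + s • v := by fun_prop
  set L := dirD n (dirD n h) with hLdef
  set M := dirD n (dirD v h) with hMdef
  set P := dirD v (dirD v h) with hPdef
  have hMv : dirD v M = dirD n P := dirD_comm cv v n
  have hdiff : ∀ q ∈ O, dirD n L q * P q + L q * dirD n P q = 2 * M q * dirD n M q := by
    intro q hq
    have e : EqOn (fun q => L q * P q) (fun q => M q * M q) O := fun q hq => by
      have := hdet q hq
      simpa [sq] using this
    have := dirD_congr hO e n hq
    rw [dirD_mul cL cP, dirD_mul cM cM] at this
    simp only at this
    linarith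
  let K : ℝ → ℝ := fun s => 2 * dirD n M (p + s • v) / L (p + s • v)
    - dirD n L (p + s • v) * M (p + s • v) / L (p + s • v) ^ 2
  have hKc : ContinuousOn K (Icc 0 b) := by
    have k1 := ((contDiff_dirD cM n).continuous.comp hline).continuousOn (s := Icc (0 : ℝ) b)
    have k2 := ((contDiff_dirD cL n).continuous.comp hline).continuousOn (s := Icc (0 : ℝ) b)
    have k3 := (cM.continuous.comp hline).continuousOn (s := Icc (0 : ℝ) b)
    have k4 := (cL.continuous.comp hline).continuousOn (s := Icc (0 : ℝ) b)
    exact ((continuousOn_const.mul k1).div k4 hL).sub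
      ((k2.mul k3).div (k4.pow 2) (fun s hs => pow_ne_zero 2 (hL s hs)))
  obtain ⟨C, hC⟩ := isCompact_Icc.exists_bound_of_continuousOn hKc
  apply eq_zero_of_abs_deriv_le_mul_abs_self_of_eq_zero_right
    (f' := fun s => dirD v M (p + s • v)) (K := C)
  · exact (cM.continuous.comp hline).continuousOn
  · intro s _
    exact (hasDerivAt_line cM p v s).hasDerivWithinAt
  · simpa using hM
  · intro s hs
    have hs' := Ico_subset_Icc_self hs
    have e1 := hdiff _ (hb s hs')
    have e2 := hdet _ (hb s hs')
    simp only [← hLdef, ← hMdef, ← hPdef] at e2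
    have hL0 := hL s hs'
    have : dirD v M (p + s • v) = K s * M (p + s • v) := by
      rw [hMv]
      simp only [K]
      field_simp
      have e3 : P (p + s • v) = M (p + s • v) ^ 2 / L (p + s • v) := by
        field_simp; linarith
      rw [e3] at e1
      field_simp at e1
      linarith
    rw [this, norm_mul]
    exact mul_le_mul_of_nonneg_right (hC s hs') (norm_nonneg _)

lemma ruling_forward (hh : ContDiff ℝ ∞ h) (hO : IsOpen O) (hb0 : 0 ≤ b)
    (hb : ∀ s ∈ Icc (0 : ℝ) b, p + s • v ∈ O) (hdet : HessDegenerateOn h n v O)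
    (hL0 : dirD n (dirD n h) p ≠ 0) (hM : dirD n (dirD v h) p = 0) :
    dirD n (dirD n h) (p + b • v) ≠ 0 ∧ dirD n (dirD v h) (p + b • v) = 0 := by
  have cn := contDiff_dirD hh n
  have cv := contDiff_dirD hh v
  have cL := contDiff_dirD cn n
  have cM := contDiff_dirD cv n
  have cP := contDiff_dirD cv v
  have cLn := contDiff_dirD cL n
  have cPn := contDiff_dirD cP n
  have cMn := contDiff_dirD cM n
  have hline : Continuous fun s : ℝ => p + s • v := by fun_prop
  suffices hL : ∀ s ∈ Icc (0 : ℝ) b, dirD n (dirD n h) (p + s • v) ≠ 0 from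
    ⟨hL b ⟨hb0, le_rfl⟩, mixed_eq_zero hh hO hb hdet hL hM b ⟨hb0, le_rfl⟩⟩
  by_contra hcon
  push Not at hcon
  set Z : Set ℝ := Icc 0 b ∩ {s | dirD n (dirD n h) (p + s • v) = 0} with hZ
  have hZc : IsCompact Z :=
    isCompact_Icc.inter_right (isClosed_eq (cL.continuous.comp hline) continuous_const)
  have hZn : Z.Nonempty := hcon
  obtain ⟨⟨hs0, hsb⟩, hsz⟩ := hZc.sInf_mem hZn
  set σ := sInf Z with hσ
  have hσpos : 0 < σ := by
    rcases hs0.lt_or_eq with h' | h'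
    · exact h'
    · exfalso; rw [← h'] at hsz; apply hL0; simpa using hsz
  have hne : ∀ c, c < σ → ∀ s ∈ Icc (0 : ℝ) c, dirD n (dirD n h) (p + s • v) ≠ 0 := by
    intro c hc s hs hz
    have : s ∈ Z := ⟨⟨hs.1, by linarith [hs.2]⟩, hz⟩
    have := csInf_le hZc.bddBelow this
    linarith [hs.2]
  set L := dirD n (dirD n h) with hLdef
  set M := dirD n (dirD v h) with hMdef
  set P := dirD v (dirD v h) with hPdef
  have hMv : dirD v M = dirD n P := dirD_comm cv v n
  have hLv : dirD v L = dirD n M := by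
    rw [hLdef, hMdef, dirD_comm cn v n, dirD_comm hh v n]
  have hMnv : dirD v (dirD n M) = dirD n (dirD n P) := by
    rw [dirD_comm cM v n, hMv]
  have hdiff : EqOn (fun q => dirD n L q * P q + L q * dirD n P q)
      (fun q => 2 * (M q * dirD n M q)) O := by
    intro q hq
    have e : EqOn (fun q => L q * P q) (fun q => M q * M q) O := fun q hq => by
      have := hdet q hq
      simpa [sq] using this
    have := dirD_congr hO e n hq
    rw [dirD_mul cL cP, dirD_mul cM cM] at this
    simp only at this ⊢
    linarith
  have hdiff2 : ∀ q ∈ O, M q = 0 → L q ≠ 0 →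
      L q * dirD n (dirD n P) q = 2 * dirD n M q ^ 2 := by
    intro q hq hM0 hL0
    have hP0 : P q = 0 := by
      have := hdet q hq
      simp only [← hLdef, ← hMdef, ← hPdef, hM0] at this
      simpa [hL0] using this
    have hP1 : dirD n P q = 0 := by
      have := hdiff hq
      simpa [hP0, hM0, hL0] using this
    have key := dirD_congr hO hdiff n hq
    have e1 : (fun q => dirD n L q * P q + L q * dirD n P q) =
      fun q => (1 : ℝ) • (fun q => dirD n L q * P q) q + (1 : ℝ) • (fun q => L q * dirD n P q) q := by
      funext q; simp
    have e2 : (fun q => 2 * (M q * dirD n M q)) =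
      fun q => (2 : ℝ) * (fun q => M q * dirD n M q) q := by
      funext q; simp
    rw [e1, dirD_const_lin (cLn.mul cP) (cL.mul cPn), dirD_mul cLn cP, dirD_mul cL cPn, e2,
      dirD_mul contDiff_const (cM.mul cMn), dirD_mul cM cMn] at key
    simp only [hP0, hP1, hM0] at key
    have : dirD n (fun _ : ℝ × ℝ => (2 : ℝ)) q = 0 := by simp [dirD]
    rw [this] at key
    simp at key
    linarith
  set c₀ := dirD n M p / L p ^ 2 with hc₀
  have hform : ∀ c, 0 ≤ c → c < σ → L (p + c • v) * (1 / L p - c₀ * c) = 1 := by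
    intro c hc0 hc
    have hcb : ∀ s ∈ Icc (0 : ℝ) c, p + s • v ∈ O := fun s hs =>
      hb s ⟨hs.1, by linarith [hs.2]⟩
    have hLc := hne c hc
    have hMc := mixed_eq_zero hh hO hcb hdet hLc hM
    simp only [← hMdef] at hMc
    have dL : ∀ s, HasDerivAt (fun s : ℝ => L (p + s • v)) (dirD n M (p + s • v)) s := by
      intro s; rw [← hLv]; exact hasDerivAt_line cL p v s
    have dm : ∀ s, HasDerivAt (fun s : ℝ => dirD n M (p + s • v))
        (dirD n (dirD n P) (p + s • v)) s := by
      intro s; rw [← hMnv]; exact hasDerivAt_line cMn p v s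
    have hg : ∀ s ∈ Icc (0 : ℝ) c, dirD n M (p + s • v) / L (p + s • v) ^ 2 = c₀ := by
      have hd : ∀ s ∈ Icc (0 : ℝ) c,
          HasDerivAt (fun s : ℝ => dirD n M (p + s • v) / L (p + s • v) ^ 2) 0 s := by
        intro s hs
        have := (dm s).div ((dL s).pow 2) (pow_ne_zero 2 (hLc s hs))
        refine this.congr_deriv ?_
        have e := hdiff2 _ (hcb s hs) (hMc s hs) (hLc s hs)
        have := hLc s hs
        rw [div_eq_zero_iff]
        left
        simp only [Pi.pow_apply]
        push_cast
        simp only [pow_one]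
        linear_combination L (p + s • v) * e
      intro s hs
      have := constant_of_has_deriv_right_zero
        (fun s hs => (hd s hs).continuousAt.continuousWithinAt)
        (fun s hs => (hd s (Ico_subset_Icc_self hs)).hasDerivWithinAt) s hs
      simpa [hc₀] using this
    have hd2 : ∀ s ∈ Icc (0 : ℝ) c,
        HasDerivAt (fun s : ℝ => (L (p + s • v))⁻¹ + c₀ * s) 0 s := by
      intro s hs
      have := ((dL s).inv (hLc s hs)).add ((hasDerivAt_id s).const_mul c₀)
      refine this.congr_deriv ?_
      rw [← hg s hs]
      ring
    have := constant_of_has_deriv_right_zero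
        (fun s hs => (hd2 s hs).continuousAt.continuousWithinAt)
        (fun s hs => (hd2 s (Ico_subset_Icc_self hs)).hasDerivWithinAt) c ⟨hc0, le_rfl⟩
    have hLcc := hLc c ⟨hc0, le_rfl⟩
    simp only [zero_smul, add_zero, mul_zero] at this
    have e : 1 / L p - c₀ * c = (L (p + c • v))⁻¹ := by
      rw [one_div]; linarith
    rw [e, mul_inv_cancel₀ hLcc]
  have hcont : Continuous fun c : ℝ => L (p + c • v) * (1 / L p - c₀ * c) :=
    (cL.continuous.comp hline).mul (by fun_prop)
  have hcl : σ ∈ closure (Ico 0 σ) := by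
    rw [closure_Ico hσpos.ne]; exact ⟨hs0, le_rfl⟩
  have hlim : L (p + σ • v) * (1 / L p - c₀ * σ) = 1 := by
    have hclosed : IsClosed {c : ℝ | L (p + c • v) * (1 / L p - c₀ * c) = 1} :=
      isClosed_eq hcont continuous_const
    exact hclosed.closure_subset_iff.2 (fun c hc => hform c hc.1 hc.2) hcl
  have hsz' : L (p + σ • v) = 0 := hsz
  rw [hsz'] at hlim
  simp at hlim

/-- If a Hessian is degenerate near a line segment, then a kernel direction at one point where the
Hessian is nonzero stays a kernel direction along the segment and the Hessian stays nonzero. -/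
lemma ruling (hh : ContDiff ℝ ∞ h) (hO : IsOpen O)
    (hb : ∀ s ∈ uIcc 0 b, p + s • v ∈ O) (hdet : HessDegenerateOn h n v O)
    (hL0 : dirD n (dirD n h) p ≠ 0) (hM : dirD n (dirD v h) p = 0) :
    dirD n (dirD n h) (p + b • v) ≠ 0 ∧ dirD n (dirD v h) (p + b • v) = 0 := by
  rcases le_total 0 b with hb0 | hb0
  · rw [uIcc_of_le hb0] at hb
    exact ruling_forward hh hO hb0 hb hdet hL0 hM
  · rw [uIcc_of_ge hb0] at hb
    have e1 : dirD (-v) h = fun p => -dirD v h p := by funext p; simp [dirD]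
    have e2 : ∀ w, dirD w (dirD (-v) h) = fun p => -dirD w (dirD v h) p := by
      intro w; rw [e1]; funext p
      simp only [dirD]
      erw [fderiv_neg]
      rfl
    have e3 : dirD (-v) (dirD (-v) h) = dirD v (dirD v h) := by
      rw [e2]; funext p; simp [dirD]
    have := ruling_forward (h := h) (n := n) (v := -v) (p := p) (b := -b) hh hO (by linarith)
      (fun s hs => by
        have := hb (-s) ⟨by linarith [hs.2], by linarith [hs.1]⟩
        simpa using this)
      (fun q hq => by rw [e3, e2]; simpa using hdet q hq) hL0 (by rw [e2]; simpa using hM)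
    rw [e2] at this
    simpa using this

end Ruling

/-- Euclidean three-space. -/
abbrev E3 := EuclideanSpace ℝ (Fin 3)

/-- The open unit-width strip. -/
def strip : Set (ℝ × ℝ) := {q | q.2 ∈ Ioo (0 : ℝ) 1}

lemma isOpen_strip : IsOpen strip := isOpen_Ioo.preimage continuous_snd

/-- `F` is smooth on the plane and isometric on the closed unit-width strip. -/
structure IsoStrip (F : ℝ × ℝ → E3) : Prop where
  smooth : ContDiff ℝ ∞ F
  norm_dirD : ∀ p : ℝ × ℝ, p.2 ∈ Icc (0 : ℝ) 1 → ∀ v : ℝ × ℝ,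
    ‖dirD v F p‖ = Real.sqrt (v.1 ^ 2 + v.2 ^ 2)

lemma exists_normal {a b : E3} (ha : ‖a‖ = 1) (hb : ‖b‖ = 1) (hab : ⟪a, b⟫ = 0) :
    ∃ N : E3, ∀ c : E3, ⟪c, a⟫ = 0 → ⟪c, b⟫ = 0 → ∃ r : ℝ, c = r • N := by
  have hon : Orthonormal ℝ ![a, b] := by
    rw [orthonormal_iff_ite]
    intro i j
    fin_cases i <;> fin_cases j <;> simp [ha, hb, hab, real_inner_comm]
  have hspan : Module.finrank ℝ (Submodule.span ℝ (range ![a, b])) = 2 := by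
    rw [finrank_span_eq_card hon.linearIndependent]; simp
  have horth : Module.finrank ℝ (Submodule.span ℝ (range ![a, b]))ᗮ = 1 := by
    have := Submodule.finrank_add_finrank_orthogonal (Submodule.span ℝ (range ![a, b]))
    rw [hspan, finrank_euclideanSpace_fin] at this
    omega
  obtain ⟨N, hN⟩ := finrank_eq_one_iff'.1 horth |>.imp fun N h => h.2
  refine ⟨N, fun c hca hcb => ?_⟩
  have hc : c ∈ (Submodule.span ℝ (range ![a, b]))ᗮ := by
    rw [Submodule.mem_orthogonal]
    intro u hu
    refine Submodule.span_induction (p := fun x _ => ⟪x, c⟫ = 0) ?_ (by simp) ?_ ?_ hu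
    · rintro x ⟨i, rfl⟩
      fin_cases i
      · simpa [real_inner_comm] using hca
      · simpa [real_inner_comm] using hcb
    · intro x y _ _ hx hy
      rw [inner_add_left, hx, hy, add_zero]
    · intro r x _ hx
      rw [real_inner_smul_left, hx, mul_zero]
  obtain ⟨r, hr⟩ := hN ⟨c, hc⟩
  exact ⟨r, by simpa using (congrArg Subtype.val hr).symm⟩

namespace IsoStrip

variable {F : ℝ × ℝ → E3} (hF : IsoStrip F)

include hF

lemma inner_dirD {p : ℝ × ℝ} (hp : p ∈ strip) (v w : ℝ × ℝ) :
    ⟪dirD v F p, dirD w F p⟫ = v.1 * w.1 + v.2 * w.2 := by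
  have hp' : p.2 ∈ Icc (0 : ℝ) 1 := Ioo_subset_Icc_self hp
  have sq : ∀ u : ℝ × ℝ, ‖dirD u F p‖ ^ 2 = u.1 ^ 2 + u.2 ^ 2 := fun u => by
    rw [hF.norm_dirD p hp', Real.sq_sqrt (by positivity)]
  have hadd : dirD (v + w) F p = dirD v F p + dirD w F p := by simp [dirD]
  have h1 := sq (v + w)
  rw [hadd, norm_add_sq_real, sq v, sq w] at h1
  simp only [Prod.fst_add, Prod.snd_add] at h1
  linarith

lemma inner_second {p : ℝ × ℝ} (hp : p ∈ strip) (u v w : ℝ × ℝ) :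
    ⟪dirD u (dirD v F) p, dirD w F p⟫ = 0 := by
  have anti : ∀ u v w : ℝ × ℝ, ⟪dirD u (dirD v F) p, dirD w F p⟫
      + ⟪dirD u (dirD w F) p, dirD v F p⟫ = 0 := by
    intro u v w
    have e : EqOn (fun q => ⟪dirD v F q, dirD w F q⟫) (fun _ => v.1 * w.1 + v.2 * w.2) strip :=
      fun q hq => hF.inner_dirD hq v w
    have := dirD_congr isOpen_strip e u hp
    rw [dirD_inner (contDiff_dirD hF.smooth v) (contDiff_dirD hF.smooth w)] at this
    simp only [dirD, fderiv_fun_const, Pi.zero_apply, zero_apply] at this ⊢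
    rw [real_inner_comm (fderiv ℝ F p v)]
    linarith
  have sym : ∀ u v w : ℝ × ℝ, ⟪dirD u (dirD v F) p, dirD w F p⟫
      = ⟪dirD v (dirD u F) p, dirD w F p⟫ := by
    intro u v w
    rw [dirD_comm hF.smooth u v]
  linarith [anti u v w, anti v w u, anti w u v, sym u v w, sym v w u, sym w u v]

lemma gauss {p : ℝ × ℝ} (hp : p ∈ strip) (u w : ℝ × ℝ) :
    ⟪dirD u (dirD u F) p, dirD w (dirD w F) p⟫ = ‖dirD u (dirD w F) p‖ ^ 2 := by
  have cu := contDiff_dirD hF.smooth u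
  have cw := contDiff_dirD hF.smooth w
  have e1 : EqOn (fun q => ⟪dirD u (dirD u F) q, dirD w F q⟫) (fun _ => (0 : ℝ)) strip :=
    fun q hq => hF.inner_second hq u u w
  have e2 : EqOn (fun q => ⟪dirD u (dirD w F) q, dirD w F q⟫) (fun _ => (0 : ℝ)) strip :=
    fun q hq => hF.inner_second hq u w w
  have h1 := dirD_congr isOpen_strip e1 w hp
  have h2 := dirD_congr isOpen_strip e2 u hp
  rw [dirD_inner (contDiff_dirD cu u) cw] at h1
  rw [dirD_inner (contDiff_dirD cw u) cw] at h2
  have z : ∀ v, dirD v (fun _ : ℝ × ℝ => (0 : ℝ)) p = 0 := by intro v; simp [dirD]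
  rw [z] at h1 h2
  simp only at h1 h2
  rw [dirD_comm cu w u, dirD_comm hF.smooth w u] at h1
  rw [real_inner_self_eq_norm_sq] at h2
  linarith

lemma normal {p : ℝ × ℝ} (hp : p ∈ strip) :
    ∃ N : E3, ∀ u v : ℝ × ℝ, ∃ r : ℝ, dirD u (dirD v F) p = r • N := by
  have hp' : p.2 ∈ Icc (0 : ℝ) 1 := Ioo_subset_Icc_self hp
  obtain ⟨N, hN⟩ := exists_normal (a := dirD (1, 0) F p) (b := dirD (0, 1) F p)
    (by rw [hF.norm_dirD p hp']; simp) (by rw [hF.norm_dirD p hp']; simp)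
    (by rw [hF.inner_dirD hp]; simp)
  exact ⟨N, fun u v => hN _ (hF.inner_second hp u v _) (hF.inner_second hp u v _)⟩

/-- A straight segment in the kernel direction of the second fundamental form stays in the
kernel direction, and the second fundamental form does not vanish along it. -/
lemma ruling_vec {p n v : ℝ × ℝ} {b : ℝ} (hb : ∀ s ∈ uIcc 0 b, p + s • v ∈ strip)
    (hL : dirD n (dirD n F) p ≠ 0) (hM : dirD n (dirD v F) p = 0) :
    dirD n (dirD n F) (p + b • v) ≠ 0 ∧ dirD n (dirD v F) (p + b • v) = 0 ∧
      dirD v (dirD v F) (p + b • v) = 0 := by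
  set e := dirD n (dirD n F) p with he
  set h : ℝ × ℝ → ℝ := fun q => ⟪F q, e⟫ with hh
  have hsm : ContDiff ℝ ∞ h := hF.smooth.inner ℝ contDiff_const
  have d2 : ∀ u w, dirD u (dirD w h) = fun q => ⟪dirD u (dirD w F) q, e⟫ := by
    intro u w
    rw [hh, dirD_inner_const hF.smooth, dirD_inner_const (contDiff_dirD hF.smooth w)]
  have hdet : HessDegenerateOn h n v strip := by
    intro q hq
    rw [d2, d2, d2]
    obtain ⟨N, hN⟩ := hF.normal hq
    obtain ⟨r1, h1⟩ := hN n n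
    obtain ⟨r2, h2⟩ := hN n v
    obtain ⟨r3, h3⟩ := hN v v
    have g := hF.gauss hq n v
    simp only
    rw [h1, h2, h3] at *
    rw [real_inner_smul_left, real_inner_smul_right, real_inner_self_eq_norm_sq, norm_smul,
      mul_pow, Real.norm_eq_abs, sq_abs] at g
    rw [real_inner_smul_left, real_inner_smul_left, real_inner_smul_left]
    by_cases hN0 : N = 0
    · simp [hN0]
    · have : ‖N‖ ^ 2 ≠ 0 := pow_ne_zero 2 (norm_ne_zero_iff.2 hN0)
      have g' : r1 * r3 = r2 ^ 2 := mul_right_cancel₀ this (by linarith)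
      linear_combination (⟪N, e⟫) ^ 2 * g'
  have := ruling hsm isOpen_strip hb hdet (by rw [d2]; exact inner_self_ne_zero.2 hL) (by rw [d2]; simp [hM])
  rw [d2, d2] at this
  obtain ⟨t1, t2⟩ := this
  simp only at t1 t2
  have hq := hb b right_mem_uIcc
  obtain ⟨N, hN⟩ := hF.normal hq
  obtain ⟨r1, h1⟩ := hN n n
  obtain ⟨r2, h2⟩ := hN n v
  obtain ⟨r3, h3⟩ := hN v v
  have g := hF.gauss hq n v
  rw [h1, real_inner_smul_left] at t1
  rw [h2, real_inner_smul_left] at t2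
  have hNe : ⟪N, e⟫ ≠ 0 := right_ne_zero_of_mul t1
  have hr1 : r1 ≠ 0 := left_ne_zero_of_mul t1
  have hN0 : N ≠ 0 := by rintro rfl; simp at hNe
  have hr2 : r2 = 0 := by simpa [hNe] using t2
  refine ⟨by rw [h1]; exact smul_ne_zero hr1 hN0, by rw [h2, hr2, zero_smul], ?_⟩
  rw [h1, h2, h3, hr2, real_inner_smul_left, real_inner_smul_right, real_inner_self_eq_norm_sq]
    at g
  have hN2 : ‖N‖ ^ 2 ≠ 0 := pow_ne_zero 2 (norm_ne_zero_iff.2 hN0)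
  have hr3 : r3 = 0 := by simpa [hr1, hN2, hN0] using g
  rw [h3, hr3, zero_smul]

/-- If all second derivatives along a segment of direction `v` vanish then `F` is affine on it. -/
lemma affine_of_second_zero (p v : ℝ × ℝ) {b : ℝ}
    (h : ∀ s ∈ Icc (0 : ℝ) b, dirD v (dirD v F) (p + s • v) = 0) :
    ∀ s ∈ Icc (0 : ℝ) b, F (p + s • v) = F p + s • dirD v F p := by
  have hd : ∀ s ∈ Icc (0 : ℝ) b, dirD v F (p + s • v) = dirD v F p := by
    intro s hs
    have := constant_of_has_deriv_right_zero (f := fun s : ℝ => dirD v F (p + s • v))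
      (a := 0) (b := b)
      (fun s _ => (hasDerivAt_line (contDiff_dirD hF.smooth v) p v s).continuousAt.continuousWithinAt)
      (fun s hs => by
        have := (hasDerivAt_line (contDiff_dirD hF.smooth v) p v s)
        rw [h s (Ico_subset_Icc_self hs)] at this
        exact this.hasDerivWithinAt) s hs
    simpa using this
  have hline : ∀ s, HasDerivAt (fun s : ℝ => F (p + s • v) - s • dirD v F p)
      (dirD v F (p + s • v) - dirD v F p) s := by
    intro s
    have := (hasDerivAt_line hF.smooth p v s).sub ((hasDerivAt_id s).smul_const (dirD v F p))
    rw [one_smul] at this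
    exact this
  intro s hs
  have := constant_of_has_deriv_right_zero (f := fun s : ℝ => F (p + s • v) - s • dirD v F p)
      (a := 0) (b := b)
      (fun s _ => (hline s).continuousAt.continuousWithinAt)
      (fun s hs => by
        have := hline s
        rw [hd s (Ico_subset_Icc_self hs), sub_self] at this
        exact this.hasDerivWithinAt) s hs
  simp only [zero_smul, add_zero, sub_zero] at this
  rw [← this]; abel

/-- At a point where the horizontal second derivative vanishes, all second derivatives vanish. -/
lemma flat_of_horizontal_zero {T : ℝ} (hT : 0 < T)
    (hper : ∀ p ∈ strip, F (p + (T, 0)) = F p) {p : ℝ × ℝ} (hp : p ∈ strip)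
    (h : dirD (1, 0) (dirD (1, 0) F) p = 0) (v : ℝ × ℝ) : dirD v (dirD v F) p = 0 := by
  have h12 : dirD (1, 0) (dirD (0, 1) F) p = 0 := by
    have := hF.gauss hp (1, 0) (0, 1)
    rw [h, inner_zero_left] at this
    exact norm_eq_zero.1 (pow_eq_zero_iff two_ne_zero |>.1 this.symm)
  have h21 : dirD (0, 1) (dirD (1, 0) F) p = 0 := by rw [dirD_comm hF.smooth]; exact h12
  have h22 : dirD (0, 1) (dirD (0, 1) F) p = 0 := by
    by_contra h22
    have hmem : ∀ s : ℝ, p + s • ((1, 0) : ℝ × ℝ) ∈ strip := fun s => by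
      simpa [strip] using hp
    have := hF.affine_of_second_zero p (1, 0) (b := T) (fun s _ =>
      (hF.ruling_vec (n := (0, 1)) (v := (1, 0)) (b := s) (fun s _ => hmem s) h22 h21).2.2) T
      ⟨hT.le, le_rfl⟩
    have e : p + T • ((1, 0) : ℝ × ℝ) = p + (T, 0) := by simp
    rw [e, hper p hp] at this
    have h0 : T • dirD (1, 0) F p = 0 := by simpa using this
    have hn := hF.norm_dirD p (Ioo_subset_Icc_self hp) (1, 0)
    rcases smul_eq_zero.1 h0 with h0 | h0
    · exact hT.ne' h0
    · rw [h0] at hn; simp at hn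
  obtain ⟨a, b⟩ := v
  have e : ((a, b) : ℝ × ℝ) = a • (1, 0) + b • (0, 1) := by simp
  have e2 : dirD (a, b) F = fun q => a • dirD (1, 0) F q + b • dirD (0, 1) F q := by
    funext q; rw [e, dirD_lin]
  rw [e2, dirD_const_lin (contDiff_dirD hF.smooth _) (contDiff_dirD hF.smooth _), e]
  simp only [dirD_lin, h, h12, h21, h22]
  simp

lemma dirD_horizontal_slant (q : ℝ × ℝ) (t : ℝ) : dirD (1, 0) (dirD (t, 1) F) q =
    t • dirD (1, 0) (dirD (1, 0) F) q + dirD (1, 0) (dirD (0, 1) F) q := by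
  have e : ((t, 1) : ℝ × ℝ) = t • (1, 0) + (1 : ℝ) • (0, 1) := by simp
  have e2 : dirD (t, 1) F = fun q => t • dirD (1, 0) F q + (1 : ℝ) • dirD (0, 1) F q := by
    funext q; rw [e, dirD_lin]
  rw [e2, dirD_const_lin (contDiff_dirD hF.smooth _) (contDiff_dirD hF.smooth _)]
  simp only [one_smul]

lemma exists_slope {p : ℝ × ℝ} (hp : p ∈ strip) (hne : dirD (1, 0) (dirD (1, 0) F) p ≠ 0) :
    ∃ t : ℝ, ∀ y ∈ Ioo (0 : ℝ) 1,
      dirD (1, 0) (dirD (1, 0) F) (p.1 + t * (y - p.2), y) ≠ 0 ∧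
      dirD (1, 0) (dirD (t, 1) F) (p.1 + t * (y - p.2), y) = 0 ∧
      dirD (t, 1) (dirD (t, 1) F) (p.1 + t * (y - p.2), y) = 0 := by
  obtain ⟨N, hN⟩ := hF.normal hp
  obtain ⟨r1, h1⟩ := hN (1, 0) (1, 0)
  obtain ⟨r2, h2⟩ := hN (1, 0) (0, 1)
  have hr1 : r1 ≠ 0 := by rintro rfl; simp at h1; exact hne h1
  refine ⟨-r2 / r1, fun y hy => ?_⟩
  have hk : dirD (1, 0) (dirD (-r2 / r1, 1) F) p = 0 := by
    rw [hF.dirD_horizontal_slant, h1, h2, smul_smul, div_mul_cancel₀ _ hr1, neg_smul]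
    simp
  have e : ∀ s : ℝ, p + s • ((-r2 / r1, 1) : ℝ × ℝ) = (p.1 + (-r2 / r1) * s, p.2 + s) := by
    intro s
    ext <;> simp [mul_comm]
  have hp1 : p.2 ∈ Ioo (0 : ℝ) 1 := hp
  have := hF.ruling_vec (n := (1, 0)) (v := (-r2 / r1, 1)) (b := y - p.2) (p := p)
    (fun s hs => by
      rw [e]
      simp only [strip, mem_ofPred_eq, mem_Ioo] at hp1 hy ⊢
      rcases le_total 0 (y - p.2) with h0 | h0
      · rw [uIcc_of_le h0] at hs; constructor <;> linarith [hs.1, hs.2]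
      · rw [uIcc_of_ge h0] at hs; constructor <;> linarith [hs.1, hs.2]) hne hk
  rw [e] at this
  simpa using this

end IsoStrip

/-- The largest extension of `t`, from the set `X` to the line, with Lipschitz constant `2`. -/
noncomputable def upperExt (X : Set ℝ) (t : ℝ → ℝ) (x : ℝ) : ℝ := ⨅ z : X, (t z + 2 * |x - z|)

section UpperExt

variable {X : Set ℝ} {t : ℝ → ℝ}

lemma upperExt_bdd (ht : ∀ x ∈ X, ∀ z ∈ X, |t x - t z| ≤ 2 * |x - z|) (x : ℝ) :
    BddBelow (range fun z : X => t z + 2 * |x - z|) := by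
  rcases X.eq_empty_or_nonempty with hX | ⟨z₀, hz₀⟩
  · subst hX
    simp [range_eq_empty]
  · refine ⟨t z₀ - 2 * |x - z₀|, ?_⟩
    rintro _ ⟨⟨z, hz⟩, rfl⟩
    have h1 := ht z hz z₀ hz₀
    have h2 := (abs_le.1 h1).1
    have h3 : |z - z₀| ≤ |x - z| + |x - z₀| := by
      have := abs_sub_le z x z₀
      rwa [abs_sub_comm z x] at this
    simp only
    linarith

lemma upperExt_eq (ht : ∀ x ∈ X, ∀ z ∈ X, |t x - t z| ≤ 2 * |x - z|) {x : ℝ} (hx : x ∈ X) :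
    upperExt X t x = t x := by
  apply le_antisymm
  · have := ciInf_le (upperExt_bdd ht x) ⟨x, hx⟩
    simpa [upperExt] using this
  · have : Nonempty X := ⟨⟨x, hx⟩⟩
    refine le_ciInf fun z => ?_
    have := (abs_le.1 (ht x hx z z.2)).2
    linarith

lemma upperExt_le (ht : ∀ x ∈ X, ∀ z ∈ X, |t x - t z| ≤ 2 * |x - z|) (x w : ℝ)
    (hX : X.Nonempty) : upperExt X t x ≤ upperExt X t w + 2 * |x - w| := by
  have := hX.to_subtype
  rw [← sub_le_iff_le_add]
  refine le_ciInf fun z => ?_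
  have h1 := ciInf_le (upperExt_bdd ht x) z
  have h2 := abs_sub_le x w z
  unfold upperExt
  linarith

lemma upperExt_lipschitz (ht : ∀ x ∈ X, ∀ z ∈ X, |t x - t z| ≤ 2 * |x - z|) (hX : X.Nonempty)
    (x w : ℝ) : |upperExt X t x - upperExt X t w| ≤ 2 * |x - w| := by
  have h1 := upperExt_le ht x w hX
  have h2 := upperExt_le ht w x hX
  rw [abs_sub_comm w x] at h2
  rw [abs_le]
  constructor <;> linarith

lemma upperExt_shift {lam : ℝ} (hX : ∀ x, x + lam ∈ X ↔ x ∈ X)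
    (ht : ∀ x ∈ X, t (x + lam) = -t x) (x : ℝ) :
    upperExt X t (x + lam) = upperExt X (fun x => -t x) x := by
  unfold upperExt
  let e : X ≃ X :=
    { toFun := fun z => ⟨z + lam, (hX z).2 z.2⟩
      invFun := fun z => ⟨z - lam, (hX _).1 (by simp)⟩
      left_inv := fun z => by simp
      right_inv := fun z => by simp }
  rw [← e.iInf_comp]
  congr 1
  funext z
  simp [e, ht z z.2]

end UpperExt

/-- A Lipschitz function which is anti-equivariant under a translation extends equivariantly. -/
lemma exists_antiperiodic_extension {X : Set ℝ} {t : ℝ → ℝ} {lam : ℝ}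
    (ht : ∀ x ∈ X, ∀ z ∈ X, |t x - t z| ≤ 2 * |x - z|) (hX : ∀ x, x + lam ∈ X ↔ x ∈ X)
    (hlam : ∀ x ∈ X, t (x + lam) = -t x) :
    ∃ E : ℝ → ℝ, (∀ x z, |E x - E z| ≤ 2 * |x - z|) ∧ (∀ x, E (x + lam) = -E x) ∧
      ∀ x ∈ X, E x = t x := by
  rcases X.eq_empty_or_nonempty with rfl | hne
  · exact ⟨fun _ => 0, by simp, by simp, by simp⟩
  have ht' : ∀ x ∈ X, ∀ z ∈ X, |(-t x) - (-t z)| ≤ 2 * |x - z| := by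
    intro x hx z hz
    rw [neg_sub_neg, abs_sub_comm]
    exact ht x hx z hz
  refine ⟨fun x => (upperExt X t x - upperExt X (fun x => -t x) x) / 2, fun x z => ?_,
    fun x => ?_, fun x hx => ?_⟩
  · have h1 := abs_le.1 (upperExt_lipschitz ht hne x z)
    have h2 := abs_le.1 (upperExt_lipschitz ht' hne x z)
    rw [abs_le]
    constructor <;> linarith [h1.1, h1.2, h2.1, h2.2]
  · have h1 := upperExt_shift hX hlam x
    have h2 := upperExt_shift (t := fun x => -t x) hX (fun x hx => by rw [hlam x hx]) x
    simp only [neg_neg] at h2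
    simp only
    rw [h1, h2]
    ring_nf
  · simp only
    rw [upperExt_eq ht hx, upperExt_eq ht' hx]
    ring

namespace IsoStrip

variable {F : ℝ × ℝ → E3} (hF : IsoStrip F)

include hF

lemma chord_affine {x t : ℝ}
    (h : ∀ y ∈ Ioo (0 : ℝ) 1, dirD (t, 1) (dirD (t, 1) F) (x + t * (y - 1 / 2), y) = 0) :
    (∀ y ∈ Icc (0 : ℝ) 1, F (x + t * (y - 1 / 2), y) =
      F (x - t / 2, 0) + y • (F (x + t / 2, 1) - F (x - t / 2, 0))) ∧
    ‖F (x + t / 2, 1) - F (x - t / 2, 0)‖ = Real.sqrt (1 + t ^ 2) := by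
  have e : ∀ s : ℝ, (x - t / 2, (0 : ℝ)) + s • ((t, 1) : ℝ × ℝ) = (x + t * (s - 1 / 2), s) := by
    intro s
    ext
    · simp; ring
    · simp
  have h' : ∀ y ∈ Icc (0 : ℝ) 1, dirD (t, 1) (dirD (t, 1) F) (x + t * (y - 1 / 2), y) = 0 := by
    have hcl : IsClosed {y : ℝ | dirD (t, 1) (dirD (t, 1) F) (x + t * (y - 1 / 2), y) = 0} := by
      refine isClosed_eq ?_ continuous_const
      exact (contDiff_dirD (contDiff_dirD hF.smooth _) _).continuous.comp (by fun_prop)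
    intro y hy
    rw [← closure_Ioo (zero_ne_one' ℝ)] at hy
    exact hcl.closure_subset_iff.2 h hy
  have key := hF.affine_of_second_zero (x - t / 2, 0) (t, 1) (b := 1)
    (fun s hs => by rw [e]; exact h' s hs)
  have k1 := key 1 ⟨zero_le_one, le_rfl⟩
  rw [e] at k1
  have k1' : F (x + t / 2, 1) - F (x - t / 2, 0) = dirD (t, 1) F (x - t / 2, 0) := by
    have e2 : x + t * (1 - 1 / 2) = x + t / 2 := by ring
    rw [e2, one_smul] at k1
    rw [k1]; abel
  refine ⟨fun y hy => ?_, ?_⟩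
  · rw [k1', ← key y hy, e]
  · rw [k1', hF.norm_dirD _ (by simp)]
    congr 1; ring

lemma slope_unique {q : ℝ × ℝ} {t t' : ℝ} (h0 : dirD (1, 0) (dirD (1, 0) F) q ≠ 0)
    (h1 : dirD (1, 0) (dirD (t, 1) F) q = 0) (h2 : dirD (1, 0) (dirD (t', 1) F) q = 0) :
    t = t' := by
  rw [hF.dirD_horizontal_slant] at h1 h2
  have : (t - t') • dirD (1, 0) (dirD (1, 0) F) q = 0 := by
    rw [sub_smul]
    rw [← h2] at h1
    exact sub_eq_zero.2 (add_right_cancel h1)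
  rcases smul_eq_zero.1 this with h | h
  · linarith
  · exact absurd h h0

/-- Second derivatives are related by the gluing map. -/
lemma second_glue {lam : ℝ} (hglue : ∀ x : ℝ, ∀ y ∈ Icc (0 : ℝ) 1, F (x + lam, 1 - y) = F (x, y))
    {q : ℝ × ℝ} (hq : q ∈ strip) (v w : ℝ × ℝ) :
    dirD (v.1, -v.2) (dirD (w.1, -w.2) F) (q.1 + lam, 1 - q.2) = dirD v (dirD w F) q := by
  have aux : ∀ (G H : ℝ × ℝ → E3), ContDiff ℝ ∞ H →
      EqOn (fun q : ℝ × ℝ => H (q.1 + lam, 1 - q.2)) G strip → ∀ v : ℝ × ℝ,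
      EqOn (fun q : ℝ × ℝ => dirD (v.1, -v.2) H (q.1 + lam, 1 - q.2)) (dirD v G) strip := by
    intro G H hH h v q hq
    have h1 := dirD_congr isOpen_strip h v hq
    rw [← h1]
    have hg : HasFDerivAt (fun q : ℝ × ℝ => (q.1 + lam, 1 - q.2))
        ((ContinuousLinearMap.fst ℝ ℝ ℝ).prod (-(ContinuousLinearMap.snd ℝ ℝ ℝ))) q := by
      refine HasFDerivAt.prodMk ?_ ?_
      · exact (hasFDerivAt_fst).add_const lam
      · exact (hasFDerivAt_snd).const_sub 1
    have h2 := ((differentiable_of_smooth hH (q.1 + lam, 1 - q.2)).hasFDerivAt.comp q hg).fderiv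
    simp only [dirD]
    have h3 : (H ∘ fun q : ℝ × ℝ => (q.1 + lam, 1 - q.2)) =
      fun q : ℝ × ℝ => H (q.1 + lam, 1 - q.2) := rfl
    rw [h3] at h2
    rw [h2]
    simp
  have s1 : EqOn (fun q : ℝ × ℝ => F (q.1 + lam, 1 - q.2)) F strip := fun q hq =>
    hglue q.1 q.2 (Ioo_subset_Icc_self hq)
  have s2 := aux F F hF.smooth s1 w
  exact aux _ _ (contDiff_dirD hF.smooth _) s2 v hq

/-- A band is swept out by a continuous equivariant family of straight chords. -/
theorem exists_bends {lam : ℝ} (hlam : 0 < lam)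
    (hglue : ∀ x : ℝ, ∀ y ∈ Icc (0 : ℝ) 1, F (x + lam, 1 - y) = F (x, y)) :
    ∃ E : ℝ → ℝ, (∀ x z, |E x - E z| ≤ 2 * |x - z|) ∧ (∀ x, E (x + lam) = -E x) ∧
      (∀ x, ∀ y ∈ Icc (0 : ℝ) 1, F (x + E x * (y - 1 / 2), y) =
        F (x - E x / 2, 0) + y • (F (x + E x / 2, 1) - F (x - E x / 2, 0))) ∧
      ∀ x, ‖F (x + E x / 2, 1) - F (x - E x / 2, 0)‖ = Real.sqrt (1 + E x ^ 2) := by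
  have hhalf : (1 / 2 : ℝ) ∈ Ioo (0 : ℝ) 1 := by norm_num
  set II := dirD (1, 0) (dirD (1, 0) F) with hII
  set X : Set ℝ := {x | II (x, 1 / 2) ≠ 0} with hX
  have hex : ∀ x, ∃ t : ℝ, x ∈ X → ∀ y ∈ Ioo (0 : ℝ) 1,
      II (x + t * (y - 1 / 2), y) ≠ 0 ∧
      dirD (1, 0) (dirD (t, 1) F) (x + t * (y - 1 / 2), y) = 0 ∧
      dirD (t, 1) (dirD (t, 1) F) (x + t * (y - 1 / 2), y) = 0 := by
    intro x
    by_cases hx : x ∈ X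
    · obtain ⟨t, ht⟩ := hF.exists_slope (p := (x, 1 / 2)) hhalf hx
      exact ⟨t, fun _ => ht⟩
    · exact ⟨0, fun h => absurd h hx⟩
  choose t ht using hex
  have hLip : ∀ x ∈ X, ∀ z ∈ X, |t x - t z| ≤ 2 * |x - z| := by
    intro x hx z hz
    by_contra hcon
    push Not at hcon
    have hne : t x - t z ≠ 0 := by
      intro h; rw [h, abs_zero] at hcon; linarith [abs_nonneg (x - z)]
    set r := (z - x) / (t x - t z) with hr
    have hr1 : |r| < 1 / 2 := by
      rw [hr, abs_div, div_lt_iff₀ (abs_pos.2 hne), abs_sub_comm z x]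
      linarith
    have hy : r + 1 / 2 ∈ Ioo (0 : ℝ) 1 := by
      have := abs_lt.1 hr1
      constructor <;> linarith [this.1, this.2]
    have e : x + t x * (r + 1 / 2 - 1 / 2) = z + t z * (r + 1 / 2 - 1 / 2) := by
      have : r * (t x - t z) = z - x := by rw [hr]; field_simp
      linarith
    have h1 := ht x hx _ hy
    have h2 := ht z hz _ hy
    rw [← e] at h2
    exact hne (sub_eq_zero.2 (hF.slope_unique h1.1 h1.2.1 h2.2.1))
  have hmid : ∀ x, ((x + lam, 1 - 1 / 2) : ℝ × ℝ) = (x + lam, 1 / 2) := by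
    intro x; norm_num
  have hgl : ∀ x (v w : ℝ × ℝ), dirD (v.1, -v.2) (dirD (w.1, -w.2) F) (x + lam, 1 / 2) =
      dirD v (dirD w F) (x, 1 / 2) := by
    intro x v w
    have := hF.second_glue hglue (q := (x, 1 / 2)) hhalf v w
    rwa [hmid] at this
  have hXlam : ∀ x, x + lam ∈ X ↔ x ∈ X := by
    intro x
    have := hgl x (1, 0) (1, 0)
    simp only [neg_zero] at this
    simp only [hX, mem_ofPred_eq, hII, this]
  have htlam : ∀ x ∈ X, t (x + lam) = -t x := by
    intro x hx
    have hx' := (hXlam x).2 hx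
    have h1 := ht x hx _ hhalf
    have h2 := ht _ hx' _ hhalf
    simp only [sub_self, mul_zero, add_zero] at h1 h2
    refine hF.slope_unique h2.1 h2.2.1 ?_
    have := hgl x (1, 0) (t x, 1)
    simp only [neg_zero] at this
    have e : dirD (t x, -1) F = fun q => (-1 : ℝ) • dirD (-t x, 1) F q + (0 : ℝ) • F q := by
      funext q
      have : ((t x, -1) : ℝ × ℝ) = (-1 : ℝ) • (-t x, 1) + (0 : ℝ) • (0, 0) := by simp
      rw [this, dirD_lin]
      simp
    rw [h1.2.1, e, dirD_const_lin (contDiff_dirD hF.smooth _) hF.smooth] at this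
    simpa using this
  obtain ⟨E, hE1, hE2, hE3⟩ := exists_antiperiodic_extension hLip hXlam htlam
  have hper : ∀ p ∈ strip, F (p + (lam + lam, 0)) = F p := by
    intro p hp
    have hp' : p.2 ∈ Icc (0 : ℝ) 1 := Ioo_subset_Icc_self hp
    have h1 := hglue p.1 p.2 hp'
    have h2 := hglue (p.1 + lam) (1 - p.2) ⟨by linarith [hp'.2], by linarith [hp'.1]⟩
    rw [← h1.symm.trans rfl, ← h2] at *
    congr 1
    ext
    · simp; ring
    · simp
  have hkey : ∀ x, ∀ y ∈ Ioo (0 : ℝ) 1,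
      dirD (E x, 1) (dirD (E x, 1) F) (x + E x * (y - 1 / 2), y) = 0 := by
    intro x y hy
    by_cases hx : x ∈ X
    · rw [hE3 x hx]; exact (ht x hx y hy).2.2
    · refine hF.flat_of_horizontal_zero (T := lam + lam) (by linarith) hper hy ?_ _
      by_contra hne
      obtain ⟨τ, hτ⟩ := hF.exists_slope (p := (x + E x * (y - 1 / 2), y)) hy hne
      simp only at hτ
      have hm := hτ _ hhalf
      set z := x + E x * (y - 1 / 2) + τ * (1 / 2 - y) with hz
      have hzX : z ∈ X := hm.1
      have hτz : τ = t z := by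
        have h2 := ht z hzX _ hhalf
        simp only [sub_self, mul_zero, add_zero] at h2
        exact hF.slope_unique hm.1 hm.2.1 h2.2.1
      rw [← hE3 z hzX] at hτz
      have hd : x - z = (E z - E x) * (y - 1 / 2) := by rw [hz, ← hτz]; ring
      have h1 : |x - z| ≤ 2 * |x - z| * |y - 1 / 2| := by
        calc |x - z| = |E z - E x| * |y - 1 / 2| := by rw [← abs_mul, ← hd]
          _ ≤ _ := by
            gcongr
            rw [abs_sub_comm x z]
            exact hE1 z x
      have hy2 : |y - 1 / 2| < 1 / 2 := by
        rw [abs_lt]; constructor <;> linarith [hy.1, hy.2]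
      have hxz : x ≠ z := fun h => hx (h ▸ hzX)
      have : 0 < |x - z| := abs_pos.2 (sub_ne_zero.2 hxz)
      nlinarith
  exact ⟨E, hE1, hE2, fun x => (hF.chord_affine (hkey x)).1, fun x => (hF.chord_affine (hkey x)).2⟩

end IsoStrip

theorem eq_of_continuous_of_mem_lattice {k : ℝ → ℝ} (hk : Continuous k) {c d a b : ℝ} (hd : 0 < d)
    (h : ∀ t ∈ uIcc a b, ∃ n : ℤ, k t = c + n * d) : k a = k b := by
  obtain ⟨m, hm⟩ := h a left_mem_uIcc
  obtain ⟨n, hn⟩ := h b right_mem_uIcc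
  have key : ∀ i : ℤ, c + (i + 1 / 2) * d ∉ uIcc (k a) (k b) := by
    intro i hi
    obtain ⟨t, ht, hti⟩ := intermediate_value_uIcc hk.continuousOn hi
    obtain ⟨j, hj⟩ := h t ht
    have h1 : ((i : ℝ) + 1 / 2) = j := by
      have : ((i : ℝ) + 1 / 2) * d = j * d := by linarith
      exact mul_right_cancel₀ hd.ne' this
    have h2 : ((2 * i + 1 : ℤ) : ℝ) = ((2 * j : ℤ) : ℝ) := by push_cast; linarith
    have h3 : (2 * i + 1 : ℤ) = 2 * j := by exact_mod_cast h2
    omega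
  rcases lt_trichotomy m n with hlt | heq | hlt
  · exfalso
    have h1 : (m : ℝ) + 1 ≤ n := by exact_mod_cast hlt
    refine key m (mem_uIcc.2 (Or.inl ⟨?_, ?_⟩)) <;> rw [‹k _ = _›] <;> nlinarith
  · rw [hm, hn, heq]
  · exfalso
    have h1 : (n : ℝ) + 1 ≤ m := by exact_mod_cast hlt
    refine key n (mem_uIcc.2 (Or.inr ⟨?_, ?_⟩)) <;> rw [‹k _ = _›] <;> nlinarith

/-- A winding number argument: a continuous function on pairs which is twisted by the glide
`(s, r) ↦ (r, s + lam)` and positive on the diagonal has a zero in the open fundamental triangle. -/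
theorem exists_zero_of_twisted {lam : ℝ} (hlam : 0 < lam) {H : ℝ → ℝ → ℂ}
    (hH : Continuous fun p : ℝ × ℝ => H p.1 p.2)
    (htwist : ∀ s r, H r (s + lam) = -H s r)
    (hdiag : ∀ s, 0 < (H s s).re ∧ (H s s).im = 0) :
    ∃ s r, s < r ∧ r < s + lam ∧ H s r = 0 := by
  by_contra! hne
  have hd0 : ∀ s, H s s ≠ 0 := fun s h => by
    have := (hdiag s).1
    rw [h] at this
    simp at this
  have hne' : ∀ s r, s ≤ r → r ≤ s + lam → H s r ≠ 0 := by
    intro s r h1 h2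
    rcases h1.eq_or_lt with rfl | h1
    · exact hd0 _
    rcases h2.eq_or_lt with rfl | h2
    · rw [htwist]; exact neg_ne_zero.2 (hd0 _)
    exact hne s r h1 h2
  set G : ℝ × ℝ → ℂ := fun p => H p.1 (p.1 + lam * max 0 (min 1 p.2)) with hG
  have hGc : Continuous G := by
    have : Continuous fun p : ℝ × ℝ => (p.1, p.1 + lam * max 0 (min 1 p.2)) := by fun_prop
    exact hH.comp this
  have hG0 : ∀ p, G p ≠ 0 := by
    intro p
    have h1 : 0 ≤ max 0 (min 1 p.2) := le_max_left _ _
    have h2 : max 0 (min 1 p.2) ≤ 1 := max_le zero_le_one (min_le_left _ _)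
    apply hne' <;> nlinarith
  have hsc : IsSimplyConnected (univ : Set (ℝ × ℝ)) := by
    have : ContractibleSpace (univ : Set (ℝ × ℝ)) :=
      (convex_univ (𝕜 := ℝ) (E := ℝ × ℝ)).contractibleSpace univ_nonempty
    exact SimplyConnectedSpace.ofContractible _
  obtain ⟨h, hc, he⟩ := Complex.exists_continuousOn_eqOn_exp_comp hsc isOpen_univ hGc.continuousOn
    (by rintro ⟨p, -, hp⟩; exact hG0 p hp)
  replace hc : Continuous h := by simpa [continuousOn_univ] using hc
  replace he : ∀ p, Complex.exp (h p) = G p := fun p => he (mem_univ p)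
  have hpi : 0 < 2 * Real.pi := by positivity
  set k : ℝ → ℂ := fun t => h (t * lam, 1 - t) - h (0, t) with hk
  have hkc : Continuous k := by
    have h1 : Continuous fun t : ℝ => (t * lam, 1 - t) := by fun_prop
    have h2 : Continuous fun t : ℝ => ((0 : ℝ), t) := by fun_prop
    exact (hc.comp h1).sub (hc.comp h2)
  have hkexp : ∀ t ∈ Icc (0 : ℝ) 1, Complex.exp (k t) = -1 := by
    intro t ht
    rw [hk]
    simp only
    rw [Complex.exp_sub, he, he]
    have e1 : G (t * lam, 1 - t) = -G (0, t) := by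
      simp only [hG]
      rw [min_eq_right ht.2, max_eq_right ht.1, min_eq_right (by linarith [ht.1]),
        max_eq_right (by linarith [ht.2])]
      rw [← htwist]
      congr 1 <;> ring
    rw [e1, neg_div, div_self (hG0 _)]
  have hkim : ∀ t ∈ Icc (0 : ℝ) 1, ∃ n : ℤ, (k t).im = Real.pi + n * (2 * Real.pi) := by
    intro t ht
    have h1 := hkexp t ht
    rw [← Complex.exp_pi_mul_I, Complex.exp_eq_exp_iff_exists_int] at h1
    obtain ⟨n, hn⟩ := h1
    exact ⟨n, by rw [hn]; simp⟩
  have hk01 : (k 0).im = (k 1).im :=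
    eq_of_continuous_of_mem_lattice (k := fun t => (k t).im) (Complex.continuous_im.comp hkc) hpi
      (fun t ht => hkim t (by rwa [uIcc_of_le zero_le_one] at ht))
  have hdd : (h (0, 0)).im = (h (lam, 0)).im := by
    refine eq_of_continuous_of_mem_lattice (k := fun t => (h (t, 0)).im) (c := 0) ?_ hpi ?_
    · have h2 : Continuous fun t : ℝ => (t, (0 : ℝ)) := by fun_prop
      exact Complex.continuous_im.comp (hc.comp h2)
    · intro t _
      have h1 := he (t, 0)
      have h2 : G (t, 0) = Complex.exp ((Real.log (H t t).re : ℝ) : ℂ) := by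
        rw [← Complex.ofReal_exp, Real.exp_log (hdiag t).1]
        simp only [hG]
        rw [min_eq_right zero_le_one, max_self, mul_zero, add_zero]
        apply Complex.ext
        · simp
        · simp [(hdiag t).2]
      rw [h2, Complex.exp_eq_exp_iff_exists_int] at h1
      obtain ⟨n, hn⟩ := h1
      exact ⟨n, by rw [hn]; simp⟩
  obtain ⟨n, hn⟩ := hkim 0 (by simp)
  have e0 : (k 0).im = (h (0, 1)).im - (h (0, 0)).im := by simp [hk]
  have e1 : (k 1).im = (h (lam, 0)).im - (h (0, 1)).im := by simp [hk]
  have h5 : Real.pi + n * (2 * Real.pi) = 0 := by linarith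
  have h6 : ((1 + 2 * n : ℤ) : ℝ) * Real.pi = 0 := by push_cast; linarith
  have h7 : ((1 + 2 * n : ℤ) : ℝ) = 0 := (mul_eq_zero.1 h6).resolve_right Real.pi_pos.ne'
  have h8 : (1 + 2 * n : ℤ) = 0 := by exact_mod_cast h7
  omega

/-- The scalar triple product. -/
def triple (a b c : E3) : ℝ :=
  a 0 * (b 1 * c 2 - b 2 * c 1) - a 1 * (b 0 * c 2 - b 2 * c 0) + a 2 * (b 0 * c 1 - b 1 * c 0)

theorem continuous_triple {X : Type*} [TopologicalSpace X] {a b c : X → E3} (ha : Continuous a)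
    (hb : Continuous b) (hc : Continuous c) : Continuous fun x => triple (a x) (b x) (c x) := by
  unfold triple
  fun_prop

theorem inner_eq (a b : E3) : ⟪a, b⟫ = a 0 * b 0 + a 1 * b 1 + a 2 * b 2 := by
  simp [PiLp.inner_apply, Fin.sum_univ_three, mul_comm]

theorem triple_sq (a b c : E3) : triple a b c ^ 2 =
    ⟪a, a⟫ * (⟪b, b⟫ * ⟪c, c⟫ - ⟪b, c⟫ ^ 2) - ⟪a, b⟫ * (⟪a, b⟫ * ⟪c, c⟫ - ⟪b, c⟫ * ⟪a, c⟫)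
      + ⟪a, c⟫ * (⟪a, b⟫ * ⟪b, c⟫ - ⟪b, b⟫ * ⟪a, c⟫) := by
  simp only [inner_eq, triple]
  ring

theorem exists_combo_of_triple_eq_zero {w u v : E3} (huv : ⟪u, v⟫ = 0) (hu : u ≠ 0) (hv : v ≠ 0)
    (h : triple w u v = 0) : w = (⟪w, u⟫ / ⟪u, u⟫) • u + (⟪w, v⟫ / ⟪v, v⟫) • v := by
  have hu' : ⟪u, u⟫ ≠ 0 := inner_self_ne_zero.2 hu
  have hv' : ⟪v, v⟫ ≠ 0 := inner_self_ne_zero.2 hv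
  have h1 := triple_sq w u v
  rw [h, huv] at h1
  rw [← sub_eq_zero, ← inner_self_eq_zero (𝕜 := ℝ)]
  have hvu : ⟪v, u⟫ = 0 := by rw [real_inner_comm]; exact huv
  simp only [inner_sub_left, inner_sub_right, inner_add_left, inner_add_right, inner_smul_left,
    inner_smul_right, huv, hvu, real_inner_comm u w, real_inner_comm v w]
  simp only [real_inner_comm w u, real_inner_comm w v] at *
  simp only [conj_trivial]
  field_simp
  linarith

/-- Abstract chord data: any glide-antiperiodic nonvanishing direction field `u` along a periodic
curve `m` has two perpendicular coplanar lines. -/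
theorem exists_perp_coplanar {lam : ℝ} (hlam : 0 < lam) {m u : ℝ → E3} (hm : Continuous m)
    (hu : Continuous u) (hmp : ∀ x, m (x + lam) = m x) (hup : ∀ x, u (x + lam) = -u x)
    (hu0 : ∀ x, u x ≠ 0) :
    ∃ s r, s < r ∧ r < s + lam ∧ ⟪u s, u r⟫ = 0 ∧ triple (m s - m r) (u s) (u r) = 0 := by
  have hH : Continuous fun p : ℝ × ℝ =>
      (⟨⟪u p.1, u p.2⟫, triple (m p.1 - m p.2) (u p.1) (u p.2)⟩ : ℂ) := by
    have e : (fun p : ℝ × ℝ => (⟨⟪u p.1, u p.2⟫, triple (m p.1 - m p.2) (u p.1) (u p.2)⟩ : ℂ)) =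
        fun p => ((⟪u p.1, u p.2⟫ : ℝ) : ℂ) +
          ((triple (m p.1 - m p.2) (u p.1) (u p.2) : ℝ) : ℂ) * Complex.I := by
      funext p
      exact Complex.mk_eq_add_mul_I _ _
    rw [e]
    have c1 : Continuous fun p : ℝ × ℝ => ⟪u p.1, u p.2⟫ := by fun_prop
    have c2 : Continuous fun p : ℝ × ℝ => triple (m p.1 - m p.2) (u p.1) (u p.2) :=
      continuous_triple (by fun_prop) (by fun_prop) (by fun_prop)
    fun_prop
  obtain ⟨s, r, h1, h2, h3⟩ := exists_zero_of_twisted hlam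
    (H := fun s r => ⟨⟪u s, u r⟫, triple (m s - m r) (u s) (u r)⟩) hH
    (fun s r => by
      apply Complex.ext
      · simp [hup, inner_neg_right, real_inner_comm]
      · simp only [hup, hmp, triple, Complex.neg_im]
        simp
        ring)
    (fun s => ⟨by have := hu0 s; simp; positivity, by simp [triple]⟩)
  exact ⟨s, r, h1, h2, congrArg Complex.re h3, congrArg Complex.im h3⟩

theorem glide_zpow {lam : ℝ} {F : ℝ × ℝ → E3}
    (hglue : ∀ x, ∀ y ∈ Icc (0 : ℝ) 1, F (x + lam, 1 - y) = F (x, y)) (k : ℤ) :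
    ∀ x, ∀ y ∈ Icc (0 : ℝ) 1, 1 / 2 + (-1 : ℝ) ^ k * (y - 1 / 2) ∈ Icc (0 : ℝ) 1 ∧
      F (x + k * lam, 1 / 2 + (-1 : ℝ) ^ k * (y - 1 / 2)) = F (x, y) := by
  have h0 : (-1 : ℝ) ≠ 0 := by norm_num
  induction k using Int.induction_on with
  | zero => intro x y hy; simpa using hy
  | succ i ih =>
    intro x y hy
    obtain ⟨h1, h2⟩ := ih x y hy
    have e : 1 / 2 + (-1 : ℝ) ^ ((i : ℤ) + 1) * (y - 1 / 2) =
        1 - (1 / 2 + (-1 : ℝ) ^ (i : ℤ) * (y - 1 / 2)) := by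
      rw [zpow_add₀ h0, zpow_one]; ring
    refine ⟨by rw [e]; constructor <;> linarith [h1.1, h1.2], ?_⟩
    rw [e, ← h2, ← hglue _ _ h1]
    congr 2
    push_cast; ring
  | pred i ih =>
    intro x y hy
    obtain ⟨h1, h2⟩ := ih x y hy
    have e : 1 / 2 + (-1 : ℝ) ^ (-(i : ℤ) - 1) * (y - 1 / 2) =
        1 - (1 / 2 + (-1 : ℝ) ^ (-(i : ℤ)) * (y - 1 / 2)) := by
      rw [zpow_sub₀ h0, zpow_one]; ring
    have h3 : 1 / 2 + (-1 : ℝ) ^ (-(i : ℤ) - 1) * (y - 1 / 2) ∈ Icc (0 : ℝ) 1 := by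
      rw [e]; constructor <;> linarith [h1.1, h1.2]
    refine ⟨h3, ?_⟩
    rw [← h2, ← hglue _ _ h3, e]
    congr 2
    · push_cast; ring
    · ring

theorem antiperiodic_zpow {lam : ℝ} {E : ℝ → ℝ} (hE : ∀ x, E (x + lam) = -E x) (k : ℤ) :
    ∀ x, E (x + k * lam) = (-1 : ℝ) ^ k * E x := by
  have h0 : (-1 : ℝ) ≠ 0 := by norm_num
  induction k using Int.induction_on with
  | zero => intro x; simp
  | succ i ih =>
    intro x
    have h2 := hE (x + ((i : ℤ) : ℝ) * lam)
    have e : x + ((i : ℤ) : ℝ) * lam + lam = x + (((i : ℤ) + 1 : ℤ) : ℝ) * lam := by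
      push_cast; ring
    rw [e, ih x] at h2
    rw [zpow_add₀ h0, zpow_one]
    linarith
  | pred i ih =>
    intro x
    have h1 := ih x
    have h2 := hE (x + ((-(i : ℤ) - 1 : ℤ) : ℝ) * lam)
    have e : x + ((-(i : ℤ) - 1 : ℤ) : ℝ) * lam + lam = x + ((-(i : ℤ) : ℤ) : ℝ) * lam := by
      push_cast; ring
    rw [e, h1] at h2
    rw [zpow_sub₀ h0, zpow_one]
    linarith

theorem chords_disjoint {lam : ℝ} (hlam : 0 < lam) {F : ℝ × ℝ → E3} {E : ℝ → ℝ}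
    (hglue : ∀ x, ∀ y ∈ Icc (0 : ℝ) 1, F (x + lam, 1 - y) = F (x, y))
    (hinj : ∀ x x' y y' : ℝ, x ∈ Ico (0 : ℝ) lam → x' ∈ Ico (0 : ℝ) lam →
      y ∈ Icc (0 : ℝ) 1 → y' ∈ Icc (0 : ℝ) 1 → F (x, y) = F (x', y') → x = x' ∧ y = y')
    (hL : ∀ x z, |E x - E z| ≤ 2 * |x - z|) (hE : ∀ x, E (x + lam) = -E x)
    {s r y y' : ℝ} (hsr : s < r) (hrs : r < s + lam) (hy : y ∈ Ioo (0 : ℝ) 1)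
    (hy' : y' ∈ Ioo (0 : ℝ) 1) :
    F (s + E s * (y - 1 / 2), y) ≠ F (r + E r * (y' - 1 / 2), y') := by
  intro h
  obtain ⟨k, hk, -⟩ := existsUnique_add_zsmul_mem_Ico hlam (s + E s * (y - 1 / 2)) 0
  obtain ⟨j, hj, -⟩ := existsUnique_add_zsmul_mem_Ico hlam (r + E r * (y' - 1 / 2)) 0
  simp only [zsmul_eq_mul, zero_add] at hk hj
  obtain ⟨m1, g1⟩ := glide_zpow hglue k (s + E s * (y - 1 / 2)) y ⟨hy.1.le, hy.2.le⟩
  obtain ⟨m2, g2⟩ := glide_zpow hglue j (r + E r * (y' - 1 / 2)) y' ⟨hy'.1.le, hy'.2.le⟩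
  obtain ⟨e1, e2⟩ := hinj _ _ _ _ hk hj m1 m2 (by rw [g1, g2, h])
  have sgn : ∀ i : ℤ, ((-1 : ℝ) ^ i) * (-1 : ℝ) ^ i = 1 := by
    intro i
    rw [← mul_zpow]; simp
  have f1 := antiperiodic_zpow hE k s
  have f2 := antiperiodic_zpow hE j r
  set S := s + k * lam with hS
  set R := r + j * lam with hR
  set η := (-1 : ℝ) ^ k * (y - 1 / 2) with hη
  have hη' : η = (-1 : ℝ) ^ j * (y' - 1 / 2) := by linarith
  have h1 : S + E S * η = R + E R * η := by
    have a1 : E S * η = E s * (y - 1 / 2) := by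
      rw [f1, hη]; linear_combination (E s * (y - 1 / 2)) * sgn k
    have a2 : E R * η = E r * (y' - 1 / 2) := by
      rw [f2, hη']; linear_combination (E r * (y' - 1 / 2)) * sgn j
    rw [a1, a2, hS, hR]
    linarith
  have hηlt : |η| < 1 / 2 := by
    have habs : |(-1 : ℝ) ^ k| = 1 := by
      have := sgn k
      nlinarith [abs_nonneg ((-1 : ℝ) ^ k), abs_mul_abs_self ((-1 : ℝ) ^ k)]
    rw [hη, abs_mul, habs, one_mul, abs_lt]
    constructor <;> linarith [hy.1, hy.2]
  have hSR : S = R := by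
    by_contra hne
    have hpos : 0 < |S - R| := abs_pos.2 (sub_ne_zero.2 hne)
    have h2 : S - R = -((E S - E R) * η) := by linarith
    have h3 : |S - R| = |E S - E R| * |η| := by
      conv_lhs => rw [h2, abs_neg, abs_mul]
    have h4 := hL S R
    nlinarith [abs_nonneg η, abs_nonneg (E S - E R)]
  have h5 : r - s = ((k - j : ℤ) : ℝ) * lam := by push_cast; linarith
  have h6 : (0 : ℝ) < ((k - j : ℤ) : ℝ) := by
    by_contra hc
    push Not at hc
    nlinarith
  have h7 : ((k - j : ℤ) : ℝ) < 1 := by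
    by_contra hc
    push Not at hc
    nlinarith
  have h8 : 0 < k - j := by exact_mod_cast h6
  have h9 : k - j < 1 := by exact_mod_cast h7
  omega

/-- Relabelling a perpendicular coplanar pair of chords so that the intersection point of their
lines lies beyond the upper endpoint of the second one. -/
theorem exists_oriented_pair {lam : ℝ} {p q : ℝ → E3} (hp : ∀ x, p (x + lam) = q x)
    (hq : ∀ x, q (x + lam) = p x) {s r α β : ℝ} (hsr : s < r) (hrs : r < s + lam)
    (hperp : ⟪q s - p s, q r - p r⟫ = 0)
    (hO : p s + α • (q s - p s) = p r + β • (q r - p r))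
    (hout : ¬ (α ∈ Ioo (0 : ℝ) 1 ∧ β ∈ Ioo (0 : ℝ) 1)) :
    ∃ s r α β : ℝ, s < r ∧ r < s + lam ∧ ⟪q s - p s, q r - p r⟫ = 0 ∧ 1 ≤ β ∧
      p s + α • (q s - p s) = p r + β • (q r - p r) := by
  have key : ∀ s r α β : ℝ, s < r → r < s + lam → ⟪q s - p s, q r - p r⟫ = 0 →
      p s + α • (q s - p s) = p r + β • (q r - p r) → β ∉ Ioo (0 : ℝ) 1 →
      ∃ s r α β : ℝ, s < r ∧ r < s + lam ∧ ⟪q s - p s, q r - p r⟫ = 0 ∧ 1 ≤ β ∧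
      p s + α • (q s - p s) = p r + β • (q r - p r) := by
    intro s r α β hsr hrs hperp hO hβ
    by_cases hb : 1 ≤ β
    · exact ⟨s, r, α, β, hsr, hrs, hperp, hb, hO⟩
    · have hb0 : β ≤ 0 := by
        by_contra hc
        exact hβ ⟨not_le.1 hc, not_le.1 hb⟩
      refine ⟨s + lam, r + lam, 1 - α, 1 - β, by linarith, by linarith, ?_, by linarith, ?_⟩
      · rw [hp, hq, hp, hq, ← neg_sub (q s), ← neg_sub (q r), inner_neg_neg, hperp]
      · rw [hp, hq, hp, hq]
        have e : ∀ (c : ℝ) (a b : E3), b + (1 - c) • (a - b) = a + c • (b - a) := by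
          intro c a b; module
        rw [e, e, hO]
  by_cases hβ : β ∈ Ioo (0 : ℝ) 1
  · refine key r (s + lam) β (1 - α) hrs (by linarith) ?_ ?_ ?_
    · rw [hp, hq, ← neg_sub (q s), inner_neg_right, real_inner_comm, hperp, neg_zero]
    · rw [hp, hq, ← hO]; module
    · rintro ⟨h1, h2⟩
      exact hout ⟨⟨by linarith, by linarith⟩, hβ⟩
  · exact key s r α β hsr hrs hperp hO hβ

/-- Every embedded band has a pair of perpendicular coplanar chords in T-shaped position. -/
theorem IsoStrip.exists_T_pattern {lam : ℝ} (hlam : 0 < lam) {F : ℝ × ℝ → E3} (hF : IsoStrip F)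
    (hglue : ∀ x, ∀ y ∈ Icc (0 : ℝ) 1, F (x + lam, 1 - y) = F (x, y))
    (hinj : ∀ x x' y y' : ℝ, x ∈ Ico (0 : ℝ) lam → x' ∈ Ico (0 : ℝ) lam →
      y ∈ Icc (0 : ℝ) 1 → y' ∈ Icc (0 : ℝ) 1 → F (x, y) = F (x', y') → x = x' ∧ y = y')
    {E : ℝ → ℝ} {p q : ℝ → E3} (hpd : ∀ x, p x = F (x - E x / 2, 0))
    (hqd : ∀ x, q x = F (x + E x / 2, 1))
    (hL : ∀ x z, |E x - E z| ≤ 2 * |x - z|) (hE : ∀ x, E (x + lam) = -E x)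
    (hchord : ∀ x, ∀ y ∈ Icc (0 : ℝ) 1, F (x + E x * (y - 1 / 2), y) = p x + y • (q x - p x))
    (hnorm : ∀ x, ‖q x - p x‖ = √(1 + E x ^ 2)) :
    ∃ s r α β : ℝ, s < r ∧ r < s + lam ∧ ⟪q s - p s, q r - p r⟫ = 0 ∧ 1 ≤ β ∧
      p s + α • (q s - p s) = p r + β • (q r - p r) := by
  have hEc : Continuous E := by
    have : LipschitzWith 2 E := LipschitzWith.of_dist_le_mul fun x z => by
      simpa [Real.dist_eq] using hL x z
    exact this.continuous
  have hFc : Continuous F := hF.smooth.continuous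
  have hpc : Continuous p := by
    rw [funext hpd]; fun_prop
  have hqc : Continuous q := by
    rw [funext hqd]; fun_prop
  have hp : ∀ x, p (x + lam) = q x := by
    intro x
    rw [hpd, hqd, hE, ← hglue _ 1 (by simp)]
    congr 2 <;> ring
  have hq : ∀ x, q (x + lam) = p x := by
    intro x
    rw [hpd, hqd, hE, ← hglue _ 0 (by simp)]
    congr 2 <;> ring
  have hm : ∀ x, F (x, 1 / 2) = p x + (1 / 2 : ℝ) • (q x - p x) := by
    intro x
    have := hchord x (1 / 2) (by norm_num)
    rwa [sub_self, mul_zero, add_zero] at this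
  have hu0 : ∀ x, q x - p x ≠ 0 := by
    intro x h
    have := hnorm x
    rw [h, norm_zero] at this
    have h2 : 0 < √(1 + E x ^ 2) := by positivity
    linarith
  obtain ⟨s, r, hsr, hrs, hperp, htr⟩ := exists_perp_coplanar hlam (m := fun x => F (x, 1 / 2))
    (u := fun x => q x - p x) (by fun_prop) (by fun_prop)
    (fun x => by
      rw [← hglue x (1 / 2) (by norm_num)]; norm_num)
    (fun x => by simp only [hp, hq, neg_sub]) hu0
  have hw := exists_combo_of_triple_eq_zero hperp (hu0 s) (hu0 r) htr
  simp only [hm] at hw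
  obtain ⟨c, d, hcd⟩ : ∃ c d : ℝ, p s + (1 / 2 : ℝ) • (q s - p s) -
      (p r + (1 / 2 : ℝ) • (q r - p r)) = c • (q s - p s) + d • (q r - p r) := ⟨_, _, hw⟩
  have hO : p s + (1 / 2 - c) • (q s - p s) = p r + (1 / 2 + d) • (q r - p r) := by
    rw [sub_smul, add_smul]
    rw [sub_eq_iff_eq_add] at hcd
    calc _ = (p s + (1 / 2 : ℝ) • (q s - p s)) - c • (q s - p s) := by abel
      _ = _ := by rw [hcd]; abel
  refine exists_oriented_pair hp hq hsr hrs hperp hO ?_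
  rintro ⟨h1, h2⟩
  refine chords_disjoint hlam hglue hinj hL hE hsr hrs h1 h2 ?_
  rw [hchord _ _ ⟨h1.1.le, h1.2.le⟩, hchord _ _ ⟨h2.1.le, h2.2.le⟩, hO]

/-- The quantitative stability of the optimal T-shaped configuration: the base half-length `c`, the
apex position `(s, h)` and the excess lengths are all controlled by `ε`. -/
theorem T_pattern_estimates {ε lam t c s h d₁ d₂ l₁ l₂ : ℝ} (hε0 : 0 < ε) (hε : ε < 1 / 384)
    (hlam : 0 < lam) (hratio : lam < √3 + ε) (hc0 : 0 ≤ c) (hc : 4 * c ^ 2 = 1 + t ^ 2)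
    (hh : 1 ≤ h) (hd₁0 : 0 ≤ d₁) (hd₂0 : 0 ≤ d₂) (hd₁ : d₁ ^ 2 = (s + c) ^ 2 + h ^ 2)
    (hd₂ : d₂ ^ 2 = (s - c) ^ 2 + h ^ 2) (hl₁ : d₁ ≤ l₁) (hl₂ : d₂ ≤ l₂)
    (hl : l₁ + l₂ = lam + t) (hl₃ : 2 * c ≤ lam - t) :
    (c - √3 / 3) ^ 2 ≤ 64 / 25 * ε ∧ s ^ 2 + (h - 1) ^ 2 ≤ 64 / 25 * ε ∧
      l₁ ^ 2 - d₁ ^ 2 ≤ 196 / 25 * ε ∧ l₂ ^ 2 - d₂ ^ 2 ≤ 196 / 25 * ε ∧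
      (lam - t) ^ 2 - (2 * c) ^ 2 ≤ 196 / 25 * ε := by
  have hw : √3 ^ 2 = 3 := Real.sq_sqrt (by norm_num)
  have hw0 : 0 ≤ √3 := Real.sqrt_nonneg 3
  have hw1 : √3 < 1.7321 := by rw [Real.sqrt_lt' (by norm_num)]; norm_num
  have hw2 : 1.732 < √3 := by rw [Real.lt_sqrt (by norm_num)]; norm_num
  set w := √3 with hwdef
  have hprod : c ^ 2 + h ^ 2 - s ^ 2 ≤ d₁ * d₂ := by
    refine (abs_le_of_sq_le_sq' ?_ (by positivity)).2
    rw [mul_pow, hd₁, hd₂]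
    nlinarith [sq_nonneg (s * h)]
  have hsum : 4 * (c ^ 2 + h ^ 2) ≤ (d₁ + d₂) ^ 2 := by
    have : (d₁ + d₂) ^ 2 = d₁ ^ 2 + d₂ ^ 2 + 2 * (d₁ * d₂) := by ring
    rw [this, hd₁, hd₂]
    linarith
  have hDL : d₁ + d₂ ≤ lam + t := by linarith
  have hL2 : (d₁ + d₂) ^ 2 ≤ (lam + t) ^ 2 := by gcongr
  have hlow : 4 * h ^ 2 + 1 ≤ lam ^ 2 + 2 * lam * t := by linarith
  have hh2 : 1 ≤ h ^ 2 := one_le_pow₀ hh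
  have hup : 1 ≤ lam ^ 2 - 2 * lam * t := by
    have : (2 * c) ^ 2 ≤ (lam - t) ^ 2 := by gcongr
    linarith
  have hlam2 : lam ^ 2 ≤ 3 + 3.467 * ε := by
    have h1 : lam ^ 2 ≤ (w + ε) ^ 2 := by gcongr
    have h2 : w * ε ≤ 1.7321 * ε := by gcongr
    have h3 : ε * ε ≤ 1 / 384 * ε := by gcongr
    linarith
  have hlamw : 3 ≤ lam ^ 2 := by linarith
  have hlamw' : w ≤ lam := by
    rw [hwdef, Real.sqrt_le_left hlam.le]
    exact hlamw
  have hlamw2 : lam ≤ 1.735 := by linarith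
  have hexc : lam ^ 2 + 2 * lam * t - 5 ≤ 6.934 * ε := by linarith
  have hexc3 : lam ^ 2 - 2 * lam * t - 1 ≤ 6.934 * ε := by linarith
  have htu : t ≤ w / 3 + ε := by
    have h1 : (lam - w) * (lam + w / 3) ≤ ε * (lam + w / 3) := by
      gcongr; linarith
    have h2 : ε * (lam + w / 3) ≤ ε * (2 * lam) := by gcongr; linarith
    have h3 : lam * t ≤ lam * (w / 3 + ε) := by linarith
    exact le_of_mul_le_mul_left h3 hlam
  have htl : w / 3 - 2 * ε ≤ t := by
    have h1 : (lam - w) * (lam + 5 * w / 3) ≤ ε * (lam + 5 * w / 3) := by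
      gcongr; linarith
    have h2 : ε * (lam + 5 * w / 3) ≤ ε * (4 * lam) := by gcongr; linarith
    have h3 : lam * (w / 3 - 2 * ε) ≤ lam * t := by linarith
    exact le_of_mul_le_mul_left h3 hlam
  have hL0 : 0 ≤ lam + t := by linarith
  have hLle : lam + t ≤ 2.32 := by linarith
  have hD2 : 2 ≤ d₁ + d₂ := by
    refine (abs_le_of_sq_le_sq' ?_ (by positivity)).2
    nlinarith [sq_nonneg c]
  have hX : lam + t - (d₁ + d₂) ≤ 1.735 * ε := by
    have h3 : (lam + t - (d₁ + d₂)) * (lam + t + (d₁ + d₂)) ≤ 6.934 * ε := by linarith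
    have h4 : 4 ≤ lam + t + (d₁ + d₂) := by linarith
    have h5 : (lam + t - (d₁ + d₂)) * 4 ≤ (lam + t - (d₁ + d₂)) * (lam + t + (d₁ + d₂)) :=
      mul_le_mul_of_nonneg_left h4 (by linarith)
    linarith
  have hd₁1 : 1 ≤ d₁ := by
    refine (abs_le_of_sq_le_sq' ?_ hd₁0).2
    rw [hd₁]; linarith [sq_nonneg (s + c)]
  have hd₂1 : 1 ≤ d₂ := by
    refine (abs_le_of_sq_le_sq' ?_ hd₂0).2
    rw [hd₂]; linarith [sq_nonneg (s - c)]
  have hfac : ∀ l d : ℝ, 0 ≤ d → d ≤ l → l - d ≤ 1.735 * ε → l ≤ 1.32 →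
      l ^ 2 - d ^ 2 ≤ 196 / 25 * ε := by
    intro l d hd0 hdl h1 h2
    have h3 : (l - d) * (l + d) ≤ (l - d) * 2.64 :=
      mul_le_mul_of_nonneg_left (by linarith) (by linarith)
    linarith
  refine ⟨?_, ?_, hfac _ _ hd₁0 hl₁ (by linarith) (by linarith),
    hfac _ _ hd₂0 hl₂ (by linarith) (by linarith), by linarith⟩
  · have hc1 : (1 : ℝ) / 2 ≤ c := by
      refine (abs_le_of_sq_le_sq' ?_ hc0).2
      linarith [sq_nonneg t]
    have h1 : (c - w / 3) * (c + w / 3) = (t - w / 3) * (t + w / 3) / 4 := by linarith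
    have h2 : |c - w / 3| ≤ ε := by
      have h3 : |c - w / 3| * (c + w / 3) = |t - w / 3| * (t + w / 3) / 4 := by
        rw [← abs_of_nonneg (show 0 ≤ c + w / 3 by linarith), ← abs_mul, h1, abs_div, abs_mul,
          abs_of_nonneg (show 0 ≤ t + w / 3 by linarith), abs_of_pos (show (0 : ℝ) < 4 by norm_num)]
      have h4 : |t - w / 3| ≤ 2 * ε := abs_le.2 ⟨by linarith, by linarith⟩
      have h5 : |t - w / 3| * (t + w / 3) ≤ 2 * ε * 2 := by
        gcongr <;> linarith
      have h6 : |c - w / 3| * 1 ≤ |c - w / 3| * (c + w / 3) := by gcongr; linarith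
      linarith
    rw [← sq_abs]
    nlinarith only [abs_nonneg (c - w / 3), h2, hε, hε0]
  · have hP : d₁ * d₂ ≤ (lam + t) ^ 2 / 2 - (s ^ 2 + c ^ 2 + h ^ 2) := by
      have : (d₁ + d₂) ^ 2 = d₁ ^ 2 + d₂ ^ 2 + 2 * (d₁ * d₂) := by ring
      rw [this, hd₁, hd₂] at hL2
      linear_combination (1 / 2 : ℝ) * hL2
    have hP2 : (d₁ * d₂) ^ 2 ≤ ((lam + t) ^ 2 / 2 - (s ^ 2 + c ^ 2 + h ^ 2)) ^ 2 := by gcongr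
    rw [mul_pow, hd₁, hd₂] at hP2
    have hP3 : s ^ 2 * ((lam + t) ^ 2 - 4 * c ^ 2) ≤
        (lam + t) ^ 2 * ((lam + t) ^ 2 / 4 - c ^ 2 - h ^ 2) := by linear_combination hP2
    have hP4 : s ^ 2 * 4 ≤ s ^ 2 * ((lam + t) ^ 2 - 4 * c ^ 2) := by gcongr; linarith
    have hP5 : (lam + t) ^ 2 * ((lam + t) ^ 2 / 4 - c ^ 2 - h ^ 2) ≤
        5.3824 * ((lam + t) ^ 2 / 4 - c ^ 2 - h ^ 2) := by
      gcongr
      · linarith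
      · calc (lam + t) ^ 2 ≤ 2.32 ^ 2 := by gcongr
          _ = 5.3824 := by norm_num
    have hh1 : h ^ 2 ≤ 1 + 1.7335 * ε := by linarith
    have hh3 : h - 1 ≤ ε := by nlinarith only [hh1, hh, hε0]
    have hh4 : (h - 1) ^ 2 ≤ 1 / 384 * ε := by
      have : (h - 1) ^ 2 ≤ ε ^ 2 := by gcongr
      nlinarith only [this, hε, hε0]
    linarith only [hP3, hP4, hP5, hh4, hε0, hlow, hexc, hh2, hc]

theorem norm_sub_combo_sq (X P Q : E3) (θ : ℝ) : ‖X - (P + θ • (Q - P))‖ ^ 2 =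
    (1 - θ) * ‖X - P‖ ^ 2 + θ * ‖X - Q‖ ^ 2 - θ * (1 - θ) * ‖Q - P‖ ^ 2 := by
  have e : Q - P = (X - P) - (X - Q) := by abel
  have e2 : X - (P + θ • (Q - P)) = (X - P) - θ • ((X - P) - (X - Q)) := by rw [← e]; abel
  rw [e2, e]
  generalize X - P = a
  generalize X - Q = b
  simp only [← real_inner_self_eq_norm_sq, inner_sub_left, inner_sub_right, inner_smul_left,
    inner_smul_right, real_inner_comm a b, conj_trivial]
  ring

/-- A nearly straight arc follows its chord. -/
theorem arc_near_chord {γ : ℝ → E3} (hγ : ∀ x y, ‖γ x - γ y‖ ≤ |x - y|) {a b κ : ℝ}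
    (hκ : 0 ≤ κ) (h : (b - a) ^ 2 - ‖γ b - γ a‖ ^ 2 ≤ 4 * κ ^ 2) {θ : ℝ} (hθ : θ ∈ Icc (0 : ℝ) 1) :
    ‖γ (a + θ * (b - a)) - (γ a + θ • (γ b - γ a))‖ ≤ κ := by
  refine (abs_le_of_sq_le_sq' ?_ hκ).2
  rw [norm_sub_combo_sq]
  have h1 : ‖γ (a + θ * (b - a)) - γ a‖ ^ 2 ≤ (θ * (b - a)) ^ 2 := by
    rw [← sq_abs (θ * (b - a))]
    have := hγ (a + θ * (b - a)) a
    rw [add_sub_cancel_left] at this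
    gcongr
  have h2 : ‖γ (a + θ * (b - a)) - γ b‖ ^ 2 ≤ ((1 - θ) * (b - a)) ^ 2 := by
    rw [← sq_abs ((1 - θ) * (b - a))]
    have := hγ (a + θ * (b - a)) b
    rw [show a + θ * (b - a) - b = -((1 - θ) * (b - a)) by ring, abs_neg] at this
    gcongr
  have h3 := mul_le_mul_of_nonneg_left h1 (sub_nonneg.2 hθ.2)
  have h4 := mul_le_mul_of_nonneg_left h2 hθ.1
  have h5 : 0 ≤ θ * (1 - θ) := mul_nonneg hθ.1 (sub_nonneg.2 hθ.2)
  have h6 := mul_le_mul_of_nonneg_left h h5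
  have h7 : θ * (1 - θ) * (4 * κ ^ 2) ≤ κ ^ 2 := by
    nlinarith [mul_nonneg (sq_nonneg κ) (sq_nonneg (2 * θ - 1))]
  nlinarith

/-- A nearly straight arc follows any segment whose endpoints are close to its endpoints. -/
theorem arc_near_segment {γ : ℝ → E3} (hγ : ∀ x y, ‖γ x - γ y‖ ≤ |x - y|) {a b κ η : ℝ}
    (hκ : 0 ≤ κ) (h : (b - a) ^ 2 - ‖γ b - γ a‖ ^ 2 ≤ 4 * κ ^ 2) {U V : E3}
    (hU : ‖γ a - U‖ ≤ η) (hV : ‖γ b - V‖ ≤ η) {θ : ℝ} (hθ : θ ∈ Icc (0 : ℝ) 1) :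
    ‖γ (a + θ * (b - a)) - (U + θ • (V - U))‖ ≤ κ + η := by
  have h1 := arc_near_chord hγ hκ h hθ
  have e : γ (a + θ * (b - a)) - (U + θ • (V - U)) =
      (γ (a + θ * (b - a)) - (γ a + θ • (γ b - γ a))) +
        ((1 - θ) • (γ a - U) + θ • (γ b - V)) := by module
  rw [e]
  refine (norm_add_le _ _).trans (add_le_add h1 ((norm_add_le _ _).trans ?_))
  rw [norm_smul, norm_smul, Real.norm_of_nonneg hθ.1, Real.norm_of_nonneg (sub_nonneg.2 hθ.2)]
  nlinarith [mul_le_mul_of_nonneg_left hU (sub_nonneg.2 hθ.2), mul_le_mul_of_nonneg_left hV hθ.1]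

theorem arc_near_segment_left {γ : ℝ → E3} (hγ : ∀ x y, ‖γ x - γ y‖ ≤ |x - y|) {a b κ η : ℝ}
    (hab : a ≤ b) (hκ : 0 ≤ κ) (h : (b - a) ^ 2 - ‖γ b - γ a‖ ^ 2 ≤ 4 * κ ^ 2) {U V : E3}
    (hU : ‖γ a - U‖ ≤ η) (hV : ‖γ b - V‖ ≤ η) {x : ℝ} (hx : x ∈ Icc a b) :
    ∃ v ∈ segment ℝ U V, ‖γ x - v‖ ≤ κ + η := by
  obtain ⟨θ, hθ, rfl⟩ : ∃ θ ∈ Icc (0 : ℝ) 1, x = a + θ * (b - a) := by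
    rcases hab.eq_or_lt with rfl | hlt
    · exact ⟨0, by simp, by rw [zero_mul, add_zero]; exact le_antisymm hx.2 hx.1⟩
    · have h0 : 0 < b - a := sub_pos.2 hlt
      refine ⟨(x - a) / (b - a), ⟨div_nonneg (sub_nonneg.2 hx.1) h0.le, ?_⟩, ?_⟩
      · rw [div_le_one h0]; linarith [hx.2]
      · field_simp; ring
  refine ⟨U + θ • (V - U), ?_, arc_near_segment hγ hκ h hU hV hθ⟩
  rw [segment_eq_image']
  exact ⟨θ, hθ, rfl⟩

theorem arc_near_segment_right {γ : ℝ → E3} (hγ : ∀ x y, ‖γ x - γ y‖ ≤ |x - y|) {a b κ η : ℝ}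
    (hκ : 0 ≤ κ) (h : (b - a) ^ 2 - ‖γ b - γ a‖ ^ 2 ≤ 4 * κ ^ 2) {U V : E3}
    (hU : ‖γ a - U‖ ≤ η) (hV : ‖γ b - V‖ ≤ η) {v : E3} (hv : v ∈ segment ℝ U V) :
    ∃ x, ‖v - γ x‖ ≤ κ + η := by
  rw [segment_eq_image'] at hv
  obtain ⟨θ, hθ, rfl⟩ := hv
  exact ⟨_, by rw [norm_sub_rev]; exact arc_near_segment hγ hκ h hU hV hθ⟩

theorem exists_weights_of_mem_convexHull {U V W z : E3} (hz : z ∈ convexHull ℝ {U, V, W}) :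
    ∃ u v w : ℝ, 0 ≤ u ∧ 0 ≤ v ∧ 0 ≤ w ∧ u + v + w = 1 ∧ z = u • U + v • V + w • W := by
  rw [convexHull_insert (by simp), mem_convexJoin] at hz
  obtain ⟨x, rfl, y, hy, hz⟩ := hz
  rw [convexHull_pair] at hy
  obtain ⟨a, b, ha, hb, hab, rfl⟩ := hy
  obtain ⟨c, d, hc, hd, hcd, rfl⟩ := hz
  refine ⟨c, d * a, d * b, hc, by positivity, by positivity, ?_, by module⟩
  rw [add_assoc, ← mul_add, hab, mul_one, hcd]

/-- If `z` in a triangle of height one lies on the prolongation of a segment `QP` beyond `P`, with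
`P` close to the side `UV` and `Q` close to the triangle, then `z` is close to whatever covers the
side. -/
theorem facet_cover {U V W z P Q P₁ Q₁ : E3} {δ r : ℝ} {S : Set E3} (hδ : 0 ≤ δ)
    (hn : ‖W - (1 / 2 : ℝ) • (U + V)‖ = 1) (hperp : ⟪W - (1 / 2 : ℝ) • (U + V), V - U⟫ = 0)
    (hz : z ∈ convexHull ℝ {U, V, W}) (hP₁ : P₁ ∈ segment ℝ U V) (hP : ‖P - P₁‖ ≤ δ)
    (hQ₁ : Q₁ ∈ convexHull ℝ {U, V, W}) (hQ : ‖Q - Q₁‖ ≤ δ) (hr0 : 0 ≤ r) (hr : r ≤ 2)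
    (hzr : ⟪W - (1 / 2 : ℝ) • (U + V), z - (P + r • (P - Q))⟫ = 0)
    (hside : ∀ v ∈ segment ℝ U V, ∃ x ∈ S, ‖v - x‖ ≤ δ) : ∃ x ∈ S, ‖z - x‖ ≤ 6 * δ := by
  set n := W - (1 / 2 : ℝ) • (U + V) with hndef
  have hW : W = n + (1 / 2 : ℝ) • (U + V) := by rw [hndef]; abel
  have hnn : ⟪n, n⟫ = 1 := by rw [real_inner_self_eq_norm_sq, hn]; norm_num
  have hVU : ⟪n, V⟫ = ⟪n, U⟫ := by rwa [inner_sub_right, sub_eq_zero] at hperp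
  have hφ : ∀ u v w : ℝ, u + v + w = 1 →
      ⟪n, u • U + v • V + w • W⟫ = ⟪n, U⟫ + w := by
    intro u v w h
    rw [hW]
    simp only [inner_add_right, inner_smul_right, hnn, hVU]
    linear_combination ⟪n, U⟫ * h
  have hlip : ∀ x : E3, |⟪n, x⟫| ≤ ‖x‖ := fun x => by
    simpa [hn] using abs_real_inner_le_norm n x
  obtain ⟨u, v, w, hu, hv, hw, huvw, rfl⟩ := exists_weights_of_mem_convexHull hz
  obtain ⟨u', v', w', hu', hv', hw', huvw', rfl⟩ := exists_weights_of_mem_convexHull hQ₁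
  obtain ⟨a, b, ha, hb, hab, rfl⟩ := hP₁
  have h1 := hφ u v w huvw
  have h2 := hφ u' v' w' huvw'
  have h3 := hφ a b 0 (by rw [add_zero]; exact hab)
  rw [zero_smul, add_zero, add_zero] at h3
  have h4 := (abs_le.1 ((hlip _).trans hP)).2
  have h5 := (abs_le.1 ((hlip _).trans hQ)).1
  simp only [inner_sub_right (x := n), h2, h3] at h4 h5
  have h6 : ⟪n, U⟫ + w = ⟪n, P⟫ + r * (⟪n, P⟫ - ⟪n, Q⟫) := by
    rw [inner_sub_right, h1, inner_add_right, inner_smul_right, inner_sub_right] at hzr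
    linarith
  have hw5 : w ≤ 5 * δ := by
    have : r * (⟪n, P⟫ - ⟪n, Q⟫) ≤ r * (2 * δ) := by gcongr; linarith
    nlinarith
  obtain ⟨x, hx, hx1⟩ := hside ((u + w / 2) • U + (v + w / 2) • V)
    ⟨u + w / 2, v + w / 2, by positivity, by positivity, by linarith, rfl⟩
  refine ⟨x, hx, ?_⟩
  have e : u • U + v • V + w • W - x = w • n + ((u + w / 2) • U + (v + w / 2) • V - x) := by
    rw [hndef]; module
  rw [e]
  refine (norm_add_le _ _).trans ?_
  rw [norm_smul, hn, Real.norm_of_nonneg hw]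
  linarith

theorem collinear_param {p₁ p₂ d₁ d₂ : ℝ} (h : p₁ * d₂ = p₂ * d₁) (hd : d₁ ^ 2 + d₂ ^ 2 ≠ 0) :
    ∃ τ : ℝ, p₁ = τ * d₁ ∧ p₂ = τ * d₂ := by
  refine ⟨(p₁ * d₁ + p₂ * d₂) / (d₁ ^ 2 + d₂ ^ 2), ?_, ?_⟩
  · field_simp; linear_combination d₂ * h
  · field_simp; linear_combination -d₁ * h

section

variable {e₁ e₂ M : E3}

theorem norm_sq_combo (h₁ : ‖e₁‖ = 1) (h₂ : ‖e₂‖ = 1) (h₁₂ : ⟪e₁, e₂⟫ = 0) (x y : ℝ) :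
    ‖x • e₁ + y • e₂‖ ^ 2 = x ^ 2 + y ^ 2 := by
  rw [norm_add_sq_real, norm_smul, norm_smul, inner_smul_left, inner_smul_right, h₁, h₂, h₁₂]
  simp

theorem norm_sq_eq_proj (h₁ : ‖e₁‖ = 1) (h₂ : ‖e₂‖ = 1) (h₁₂ : ⟪e₁, e₂⟫ = 0) (v : E3) :
    ‖v‖ ^ 2 = ⟪v, e₁⟫ ^ 2 + ⟪v, e₂⟫ ^ 2 + ‖v - (⟪v, e₁⟫ • e₁ + ⟪v, e₂⟫ • e₂)‖ ^ 2 := by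
  have h₂₁ : ⟪e₂, e₁⟫ = 0 := by rw [real_inner_comm]; exact h₁₂
  rw [norm_sub_sq_real, norm_sq_combo h₁ h₂ h₁₂, inner_add_right, inner_smul_right,
    inner_smul_right]
  ring

/-- Distance from the plane is at most the distance to any of its points. -/
theorem norm_sub_proj_le (h₁ : ‖e₁‖ = 1) (h₂ : ‖e₂‖ = 1) (h₁₂ : ⟪e₁, e₂⟫ = 0) (v : E3) (x y : ℝ) :
    ‖v - (⟪v, e₁⟫ • e₁ + ⟪v, e₂⟫ • e₂)‖ ≤ ‖v - (x • e₁ + y • e₂)‖ := by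
  have h₂₁ : ⟪e₂, e₁⟫ = 0 := by rw [real_inner_comm]; exact h₁₂
  have h := norm_sq_eq_proj h₁ h₂ h₁₂ (v - (x • e₁ + y • e₂))
  have i1 : ⟪v - (x • e₁ + y • e₂), e₁⟫ = ⟪v, e₁⟫ - x := by
    simp [inner_sub_left, inner_add_left, inner_smul_left, h₁, h₂₁]
  have i2 : ⟪v - (x • e₁ + y • e₂), e₂⟫ = ⟪v, e₂⟫ - y := by
    simp [inner_sub_left, inner_add_left, inner_smul_left, h₂, h₁₂]
  rw [i1, i2] at h
  have e : v - (x • e₁ + y • e₂) - ((⟪v, e₁⟫ - x) • e₁ + (⟪v, e₂⟫ - y) • e₂) =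
      v - (⟪v, e₁⟫ • e₁ + ⟪v, e₂⟫ • e₂) := by module
  rw [e] at h
  refine (abs_le_of_sq_le_sq' ?_ (norm_nonneg _)).2
  rw [h]
  nlinarith [sq_nonneg (⟪v, e₁⟫ - x), sq_nonneg (⟪v, e₂⟫ - y)]

theorem exists_coords_of_mem_convexHull {g : ℝ} {z : E3}
    (hz : z ∈ convexHull ℝ {M - g • e₁, M + g • e₁, M + e₂}) :
    ∃ x y : ℝ, z = M + (x • e₁ + y • e₂) := by
  obtain ⟨u, v, w, -, -, -, h, rfl⟩ := exists_weights_of_mem_convexHull hz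
  refine ⟨(v - u) * g, w, ?_⟩
  have : M = (u + v + w) • M := by rw [h, one_smul]
  conv_rhs => rw [this]
  module

theorem dist_vertices (h₁ : ‖e₁‖ = 1) (h₂ : ‖e₂‖ = 1) (h₁₂ : ⟪e₁, e₂⟫ = 0) :
    dist (M - (√3 / 3) • e₁) (M + (√3 / 3) • e₁) = 2 * √3 / 3 ∧
      dist (M + (√3 / 3) • e₁) (M + e₂) = 2 * √3 / 3 ∧
      dist (M + e₂) (M - (√3 / 3) • e₁) = 2 * √3 / 3 := by
  have hw : √3 ^ 2 = 3 := Real.sq_sqrt (by norm_num)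
  have key : ∀ x y : ℝ, x ^ 2 + y ^ 2 = 4 / 3 → ‖x • e₁ + y • e₂‖ = 2 * √3 / 3 := by
    intro x y h
    rw [← sq_eq_sq₀ (norm_nonneg _) (by positivity), norm_sq_combo h₁ h₂ h₁₂, h]
    linear_combination (-(4 : ℝ) / 9) * hw
  refine ⟨?_, ?_, ?_⟩
  · rw [dist_eq_norm, ← key (-(2 * √3 / 3)) 0 (by linear_combination ((4 : ℝ) / 9) * hw)]
    congr 1; module
  · rw [dist_eq_norm, ← key (√3 / 3) (-1) (by linear_combination ((1 : ℝ) / 9) * hw)]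
    congr 1; module
  · rw [dist_eq_norm, ← key (√3 / 3) 1 (by linear_combination ((1 : ℝ) / 9) * hw)]
    congr 1; module

theorem norm_sub_le_of_mem_convexHull (h₁ : ‖e₁‖ = 1) (h₂ : ‖e₂‖ = 1) (h₁₂ : ⟪e₁, e₂⟫ = 0)
    {z z' : E3} (hz : z ∈ convexHull ℝ {M - (√3 / 3) • e₁, M + (√3 / 3) • e₁, M + e₂})
    (hz' : z' ∈ convexHull ℝ {M - (√3 / 3) • e₁, M + (√3 / 3) • e₁, M + e₂}) :
    ‖z - z'‖ ≤ 2 * √3 / 3 := by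
  obtain ⟨d1, d2, d3⟩ := dist_vertices (M := M) h₁ h₂ h₁₂
  have h0 : 0 ≤ 2 * √3 / 3 := by positivity
  obtain ⟨x, hx, y, hy, hxy⟩ := convexHull_exists_dist_ge2 hz hz'
  rw [← dist_eq_norm]
  refine hxy.trans ?_
  rcases hx with rfl | rfl | rfl <;> rcases hy with rfl | rfl | rfl <;>
    first
    | rw [dist_self]; exact h0
    | rw [d1] | rw [d2] | rw [d3] | rw [dist_comm, d1] | rw [dist_comm, d2] | rw [dist_comm, d3]

end

section

variable {e₁ e₂ M : E3}

/-- A line meeting the vertical over `z`, through points near a side `UV` and near the opposite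
sides, with `z` not above the segment: prolongation length is bounded. -/
theorem prolongation_le (h₁ : ‖e₁‖ = 1) (h₂ : ‖e₂‖ = 1) (h₁₂ : ⟪e₁, e₂⟫ = 0)
    {z P Q P₁ Q₁ : E3} {δ r : ℝ} (hδ : δ ≤ 4 / 25)
    (hz : z ∈ convexHull ℝ {M - (√3 / 3) • e₁, M + (√3 / 3) • e₁, M + e₂})
    (hP₁ : P₁ ∈ convexHull ℝ {M - (√3 / 3) • e₁, M + (√3 / 3) • e₁, M + e₂})
    (hQ₁ : Q₁ ∈ convexHull ℝ {M - (√3 / 3) • e₁, M + (√3 / 3) • e₁, M + e₂})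
    (hP : ‖P - P₁‖ ≤ δ) (hQ : ‖Q - Q₁‖ ≤ δ) (hPQ : 1 ≤ ‖P - Q‖) (hr0 : 0 ≤ r)
    (hr₁ : ⟪z - P, e₁⟫ = r * ⟪P - Q, e₁⟫) (hr₂ : ⟪z - P, e₂⟫ = r * ⟪P - Q, e₂⟫) : r ≤ 2 := by
  obtain ⟨x, y, hx⟩ := exists_coords_of_mem_convexHull hP₁
  obtain ⟨x', y', hx'⟩ := exists_coords_of_mem_convexHull hQ₁
  have hw1 : √3 < 1.7321 := by rw [Real.sqrt_lt' (by norm_num)]; norm_num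
  have hzP : ‖z - P‖ ≤ 1.32 := by
    have h3 := norm_sub_le_of_mem_convexHull h₁ h₂ h₁₂ hz hP₁
    have h4 : z - P = (z - P₁) - (P - P₁) := by abel
    rw [h4]
    refine (norm_sub_le _ _).trans ?_
    linarith
  set D := P - Q with hD
  have h5 : ‖D - (⟪D, e₁⟫ • e₁ + ⟪D, e₂⟫ • e₂)‖ ≤ 2 * δ := by
    refine (norm_sub_proj_le h₁ h₂ h₁₂ D (x - x') (y - y')).trans ?_
    have e : D - ((x - x') • e₁ + (y - y') • e₂) = (P - P₁) - (Q - Q₁) := by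
      rw [hD, hx, hx']; module
    rw [e]
    refine (norm_sub_le _ _).trans ?_
    linarith
  have h6 := norm_sq_combo h₁ h₂ h₁₂ ⟪D, e₁⟫ ⟪D, e₂⟫
  have h7 : 0.68 ≤ ‖⟪D, e₁⟫ • e₁ + ⟪D, e₂⟫ • e₂‖ := by
    have := norm_sub_norm_le D (⟪D, e₁⟫ • e₁ + ⟪D, e₂⟫ • e₂)
    linarith
  have h8 := norm_sq_eq_proj h₁ h₂ h₁₂ (z - P)
  rw [hr₁, hr₂] at h8
  have h9 : (r * ‖⟪D, e₁⟫ • e₁ + ⟪D, e₂⟫ • e₂‖) ^ 2 ≤ 1.32 ^ 2 := by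
    have h10 : ‖z - P‖ ^ 2 ≤ 1.32 ^ 2 := by gcongr
    rw [mul_pow, h6]
    nlinarith [sq_nonneg ‖z - P - ((r * ⟪D, e₁⟫) • e₁ + (r * ⟪D, e₂⟫) • e₂)‖]
  have h11 := (abs_le_of_sq_le_sq' h9 (by norm_num)).2
  have h12 : r * 0.68 ≤ r * ‖⟪D, e₁⟫ • e₁ + ⟪D, e₂⟫ • e₂‖ := by gcongr
  linarith

theorem triangle_covered (h₁ : ‖e₁‖ = 1) (h₂ : ‖e₂‖ = 1) (h₁₂ : ⟪e₁, e₂⟫ = 0) {A B C : E3}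
    (hA : A = M - (√3 / 3) • e₁) (hB : B = M + (√3 / 3) • e₁) (hC : C = M + e₂)
    {P Q : ℝ → E3} (hPc : Continuous P) (hQc : Continuous Q) {s s' δ : ℝ} (hss : s ≤ s')
    (hδ0 : 0 ≤ δ) (hδ : δ ≤ 4 / 25) {S : Set E3} (hend₁ : P s' = Q s) (hend₂ : Q s' = P s)
    (hP : ∀ x ∈ Icc s s', ∃ v ∈ segment ℝ A C ∪ segment ℝ C B, ‖P x - v‖ ≤ δ)
    (hQ : ∀ x ∈ Icc s s', ∃ v ∈ segment ℝ A B, ‖Q x - v‖ ≤ δ)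
    (hPQ : ∀ x, 1 ≤ ‖P x - Q x‖) (hS : ∀ x, ∀ θ ∈ Icc (0 : ℝ) 1, P x + θ • (Q x - P x) ∈ S)
    (hAC : ∀ v ∈ segment ℝ A C, ∃ x ∈ S, ‖v - x‖ ≤ δ)
    (hCB : ∀ v ∈ segment ℝ C B, ∃ x ∈ S, ‖v - x‖ ≤ δ)
    (hAB : ∀ v ∈ segment ℝ A B, ∃ x ∈ S, ‖v - x‖ ≤ δ) {z : E3} (hz : z ∈ convexHull ℝ {A, B, C}) :
    ∃ x ∈ S, ‖z - x‖ ≤ 6 * δ := by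
  have h₂₁ : ⟪e₂, e₁⟫ = 0 := by rw [real_inner_comm]; exact h₁₂
  have h₁₁ : ⟪e₁, e₁⟫ = 1 := by rw [real_inner_self_eq_norm_sq, h₁]; norm_num
  have h₂₂ : ⟪e₂, e₂⟫ = 1 := by rw [real_inner_self_eq_norm_sq, h₂]; norm_num
  have hw : √3 ^ 2 = 3 := Real.sq_sqrt (by norm_num)
  obtain ⟨x, hx, hx0⟩ : ∃ x ∈ Icc s s', ⟪P x - z, e₁⟫ * ⟪Q x - z, e₂⟫ -
      ⟪P x - z, e₂⟫ * ⟪Q x - z, e₁⟫ = 0 := by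
    set Φ : ℝ → ℝ := fun x => ⟪P x - z, e₁⟫ * ⟪Q x - z, e₂⟫ - ⟪P x - z, e₂⟫ * ⟪Q x - z, e₁⟫
    have hΦ : Continuous Φ := by fun_prop
    have hneg : Φ s' = -Φ s := by
      simp only [Φ, hend₁, hend₂]; ring
    have h0 : (0 : ℝ) ∈ uIcc (Φ s) (Φ s') := by
      rw [hneg, mem_uIcc]
      rcases le_total 0 (Φ s) with h | h
      · exact Or.inr ⟨by linarith, h⟩
      · exact Or.inl ⟨h, by linarith⟩
    obtain ⟨x, hx, hx0⟩ := intermediate_value_uIcc hΦ.continuousOn h0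
    rw [uIcc_of_le hss] at hx
    exact ⟨x, hx, hx0⟩
  obtain ⟨P₁, hP₁, hPP⟩ := hP x hx
  obtain ⟨Q₁, hQ₁, hQQ⟩ := hQ x hx
  have hPQx := hPQ x
  have hSx := hS x
  generalize P x = P at *
  generalize Q x = Q at *
  have sAC : segment ℝ A C ⊆ convexHull ℝ {A, B, C} := by
    rw [← convexHull_pair]; exact convexHull_mono (by intro v; simp; tauto)
  have sCB : segment ℝ C B ⊆ convexHull ℝ {A, B, C} := by
    rw [← convexHull_pair]; exact convexHull_mono (by intro v; simp; tauto)
  have sAB : segment ℝ A B ⊆ convexHull ℝ {A, B, C} := by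
    rw [← convexHull_pair]; exact convexHull_mono (by intro v; simp; tauto)
  have hP₁h : P₁ ∈ convexHull ℝ {A, B, C} := hP₁.elim (fun h => sAC h) (fun h => sCB h)
  have hQ₁h : Q₁ ∈ convexHull ℝ {A, B, C} := sAB hQ₁
  have hcoord : ∀ v ∈ convexHull ℝ {A, B, C}, ∃ x y : ℝ, v = M + (x • e₁ + y • e₂) := by
    rw [hA, hB, hC]; exact fun v hv => exists_coords_of_mem_convexHull hv
  -- the horizontal projections of `P` and `Q` are distinct
  have hne : ⟪Q - P, e₁⟫ ^ 2 + ⟪Q - P, e₂⟫ ^ 2 ≠ 0 := by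
    intro h0
    obtain ⟨a, b, rfl⟩ := hcoord _ hP₁h
    obtain ⟨c, d, rfl⟩ := hcoord _ hQ₁h
    have h3 := norm_sub_proj_le h₁ h₂ h₁₂ (Q - P) (c - a) (d - b)
    have e : Q - P - ((c - a) • e₁ + (d - b) • e₂) =
        (Q - (M + (c • e₁ + d • e₂))) - (P - (M + (a • e₁ + b • e₂))) := by module
    rw [e] at h3
    have h4 := h3.trans (norm_sub_le _ _)
    have h5 := norm_sq_combo h₁ h₂ h₁₂ ⟪Q - P, e₁⟫ ⟪Q - P, e₂⟫
    rw [h0, sq_eq_zero_iff, norm_eq_zero] at h5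
    rw [h5, sub_zero, norm_sub_rev] at h4
    linarith
  obtain ⟨τ, hτ₁, hτ₂⟩ : ∃ τ : ℝ, ⟪z - P, e₁⟫ = τ * ⟪Q - P, e₁⟫ ∧ ⟪z - P, e₂⟫ = τ * ⟪Q - P, e₂⟫ := by
    refine collinear_param ?_ hne
    simp only [inner_sub_left] at hx0 ⊢
    linear_combination -hx0
  by_cases hτ : τ ∈ Icc (0 : ℝ) 1
  · refine ⟨_, hSx τ hτ, ?_⟩
    obtain ⟨a, b, rfl⟩ := hcoord _ hP₁h
    obtain ⟨c, d, rfl⟩ := hcoord _ hQ₁h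
    obtain ⟨x, y, rfl⟩ := hcoord _ hz
    set v := P + τ • (Q - P) - (M + (x • e₁ + y • e₂)) with hv
    have i1 : ⟪v, e₁⟫ = 0 := by
      have : v = τ • (Q - P) - (M + (x • e₁ + y • e₂) - P) := by rw [hv]; abel
      rw [this, inner_sub_left, inner_smul_left, hτ₁]; simp
    have i2 : ⟪v, e₂⟫ = 0 := by
      have : v = τ • (Q - P) - (M + (x • e₁ + y • e₂) - P) := by rw [hv]; abel
      rw [this, inner_sub_left, inner_smul_left, hτ₂]; simp
    have h3 := norm_sub_proj_le h₁ h₂ h₁₂ v (a + τ * (c - a) - x) (b + τ * (d - b) - y)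
    rw [i1, i2, zero_smul, zero_smul, add_zero, sub_zero] at h3
    have e : v - ((a + τ * (c - a) - x) • e₁ + (b + τ * (d - b) - y) • e₂) =
        (1 - τ) • (P - (M + (a • e₁ + b • e₂))) + τ • (Q - (M + (c • e₁ + d • e₂))) := by
      rw [hv]; module
    rw [e] at h3
    have h4 := h3.trans (norm_add_le _ _)
    rw [norm_smul, norm_smul, Real.norm_of_nonneg hτ.1, Real.norm_of_nonneg (sub_nonneg.2 hτ.2)]
      at h4
    rw [norm_sub_rev]
    nlinarith [mul_le_mul_of_nonneg_left hPP (sub_nonneg.2 hτ.2), mul_le_mul_of_nonneg_left hQQ hτ.1]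
  by_cases hτ0 : τ < 0
  · have hr₁ : ⟪z - P, e₁⟫ = -τ * ⟪P - Q, e₁⟫ := by
      rw [hτ₁, ← neg_sub Q P, inner_neg_left]; ring
    have hr₂ : ⟪z - P, e₂⟫ = -τ * ⟪P - Q, e₂⟫ := by
      rw [hτ₂, ← neg_sub Q P, inner_neg_left]; ring
    have hr : -τ ≤ 2 := by
      rw [hA, hB, hC] at hz hP₁h hQ₁h
      exact prolongation_le h₁ h₂ h₁₂ hδ hz hP₁h hQ₁h hPP hQQ hPQx (by linarith) hr₁ hr₂
    have hz₁ : ⟪e₁, z - (P + (-τ) • (P - Q))⟫ = 0 := by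
      rw [real_inner_comm, ← sub_sub, inner_sub_left, inner_smul_left, hr₁]; simp
    have hz₂ : ⟪e₂, z - (P + (-τ) • (P - Q))⟫ = 0 := by
      rw [real_inner_comm, ← sub_sub, inner_sub_left, inner_smul_left, hr₂]; simp
    rcases hP₁ with hP₁ | hP₁
    · have hn : B - (1 / 2 : ℝ) • (A + C) = (√3 / 2) • e₁ + (-(1 / 2) : ℝ) • e₂ := by
        rw [hA, hB, hC]; module
      have hset : ({A, C, B} : Set E3) = {A, B, C} := by rw [Set.pair_comm C B]
      refine facet_cover (U := A) (V := C) (W := B) hδ0 ?_ ?_ (hset ▸ hz) hP₁ hPP (hset ▸ hQ₁h) hQQ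
        (by linarith) hr ?_ hAC
      · rw [hn, ← sq_eq_sq₀ (norm_nonneg _) zero_le_one, norm_sq_combo h₁ h₂ h₁₂]
        linear_combination (1 / 4 : ℝ) * hw
      · rw [hn, hA, hC]
        simp only [inner_add_left, inner_smul_left, inner_sub_right, inner_add_right,
          inner_smul_right, h₁₁, h₁₂, h₂₁, h₂₂, conj_trivial]
        linear_combination (1 / 6 : ℝ) * hw
      · rw [hn, inner_add_left, inner_smul_left, inner_smul_left, hz₁, hz₂]; simp
    · have hn : A - (1 / 2 : ℝ) • (C + B) = (-(√3 / 2)) • e₁ + (-(1 / 2) : ℝ) • e₂ := by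
        rw [hA, hB, hC]; module
      have hset : ({C, B, A} : Set E3) = {A, B, C} := by
        ext v; simp only [mem_insert_iff, mem_singleton_iff]; tauto
      refine facet_cover (U := C) (V := B) (W := A) hδ0 ?_ ?_ (hset ▸ hz) hP₁ hPP (hset ▸ hQ₁h) hQQ
        (by linarith) hr ?_ hCB
      · rw [hn, ← sq_eq_sq₀ (norm_nonneg _) zero_le_one, norm_sq_combo h₁ h₂ h₁₂]
        linear_combination (1 / 4 : ℝ) * hw
      · rw [hn, hB, hC]
        simp only [inner_add_left, inner_smul_left, inner_sub_right, inner_add_right,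
          inner_smul_right, h₁₁, h₁₂, h₂₁, h₂₂, conj_trivial]
        linear_combination (-(1 / 6) : ℝ) * hw
      · rw [hn, inner_add_left, inner_smul_left, inner_smul_left, hz₁, hz₂]; simp
  · have hτ1 : 1 < τ := by
      by_contra hc
      exact hτ ⟨not_lt.1 hτ0, not_lt.1 hc⟩
    have eQ : z - Q = (z - P) - (Q - P) := by abel
    have hr₁ : ⟪z - Q, e₁⟫ = (τ - 1) * ⟪Q - P, e₁⟫ := by
      rw [eQ, inner_sub_left, hτ₁]; ring
    have hr₂ : ⟪z - Q, e₂⟫ = (τ - 1) * ⟪Q - P, e₂⟫ := by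
      rw [eQ, inner_sub_left, hτ₂]; ring
    have hr : τ - 1 ≤ 2 := by
      rw [hA, hB, hC] at hz hP₁h hQ₁h
      exact prolongation_le h₁ h₂ h₁₂ hδ hz hQ₁h hP₁h hQQ hPP (by rwa [norm_sub_rev])
        (by linarith) hr₁ hr₂
    have hz₂ : ⟪e₂, z - (Q + (τ - 1) • (Q - P))⟫ = 0 := by
      rw [real_inner_comm, ← sub_sub, inner_sub_left, inner_smul_left, hr₂]; simp
    have hn : C - (1 / 2 : ℝ) • (A + B) = e₂ := by
      rw [hA, hB, hC]; module
    refine facet_cover (U := A) (V := B) (W := C) hδ0 ?_ ?_ hz hQ₁ hQQ hP₁h hPP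
      (by linarith) hr ?_ hAB
    · rw [hn, h₂]
    · rw [hn, hA, hB]
      simp only [inner_sub_right, inner_add_right, inner_smul_right, h₂₁]
      ring
    · rw [hn, hz₂]

end

theorem IsoStrip.norm_bottom_sub_le {F : ℝ × ℝ → E3} (hF : IsoStrip F) (x y : ℝ) :
    ‖F (x, 0) - F (y, 0)‖ ≤ |x - y| := by
  have hd : ∀ z : ℝ, HasDerivAt (fun z : ℝ => F (z, 0)) (dirD (1, 0) F (z, 0)) z := by
    intro z
    have h1 : HasDerivAt (fun z : ℝ => (z, (0 : ℝ))) ((1 : ℝ), (0 : ℝ)) z :=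
      (hasDerivAt_id z).prodMk (hasDerivAt_const z 0)
    exact (((hF.smooth.differentiable (by simp)) (z, 0)).hasFDerivAt).comp_hasDerivAt z h1
  have := convex_univ.norm_image_sub_le_of_norm_deriv_le (f := fun z : ℝ => F (z, 0)) (C := 1)
    (fun z _ => (hd z).differentiableAt)
    (fun z _ => by
      rw [(hd z).deriv, hF.norm_dirD _ (by simp)]
      simp)
    (mem_univ y) (mem_univ x)
  simpa using this

theorem infDist_combo_le {K : Set E3} (hK : Convex ℝ K) {P Q : E3} {δ y : ℝ}
    (hP : ∃ v ∈ K, ‖P - v‖ ≤ δ) (hQ : ∃ v ∈ K, ‖Q - v‖ ≤ δ) (hy : y ∈ Icc (0 : ℝ) 1) :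
    Metric.infDist (P + y • (Q - P)) K ≤ δ := by
  obtain ⟨v, hv, hPv⟩ := hP
  obtain ⟨w, hw, hQw⟩ := hQ
  have hm : v + y • (w - v) ∈ K := hK.add_smul_sub_mem hv hw hy
  refine (Metric.infDist_le_dist_of_mem hm).trans ?_
  rw [dist_eq_norm]
  have e : P + y • (Q - P) - (v + y • (w - v)) = (1 - y) • (P - v) + y • (Q - w) := by module
  rw [e]
  refine (norm_add_le _ _).trans ?_
  rw [norm_smul, norm_smul, Real.norm_of_nonneg hy.1, Real.norm_of_nonneg (sub_nonneg.2 hy.2)]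
  nlinarith [mul_le_mul_of_nonneg_left hPv (sub_nonneg.2 hy.2), mul_le_mul_of_nonneg_left hQw hy.1]

/-- Every point of the flat band lies on one of the bends. -/
theorem exists_bend_through {lam : ℝ} (hlam : 0 < lam) {E : ℝ → ℝ} (hEc : Continuous E)
    (hL : ∀ x z, |E x - E z| ≤ 2 * |x - z|) (hE : ∀ x, E (x + lam) = -E x) (x : ℝ) {y : ℝ}
    (hy : y ∈ Icc (0 : ℝ) 1) : ∃ z, z + E z * (y - 1 / 2) = x := by
  have hb : ∀ z, |E z * (y - 1 / 2)| ≤ lam := by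
    intro z
    have h3 := hL (z + lam) z
    rw [hE, add_sub_cancel_left, abs_of_pos hlam, abs_le] at h3
    have h4 : |E z| ≤ lam := abs_le.2 ⟨by linarith, by linarith⟩
    have h5 : |y - 1 / 2| ≤ 1 := abs_le.2 ⟨by linarith [hy.1], by linarith [hy.2]⟩
    rw [abs_mul]
    nlinarith [abs_nonneg (E z), abs_nonneg (y - 1 / 2)]
  have hφ : ContinuousOn (fun z => z + E z * (y - 1 / 2)) (Icc (x - lam) (x + lam)) := by
    fun_prop
  obtain ⟨z, -, hz⟩ := intermediate_value_Icc (by linarith) hφ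
    (show x ∈ Icc _ _ from ⟨by linarith [(abs_le.1 (hb (x - lam))).2],
      by linarith [(abs_le.1 (hb (x + lam))).1]⟩)
  exact ⟨z, hz⟩

set_option maxHeartbeats 400000 in
theorem IsoStrip.exists_close_triangle {ε lam : ℝ} (hε0 : 0 < ε) (hε : ε < 1 / 384)
    (hlam : 0 < lam) (hratio : lam < √3 + ε) {F : ℝ × ℝ → E3} (hF : IsoStrip F)
    (hglue : ∀ x, ∀ y ∈ Icc (0 : ℝ) 1, F (x + lam, 1 - y) = F (x, y))
    (hinj : ∀ x x' y y' : ℝ, x ∈ Ico (0 : ℝ) lam → x' ∈ Ico (0 : ℝ) lam →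
      y ∈ Icc (0 : ℝ) 1 → y' ∈ Icc (0 : ℝ) 1 → F (x, y) = F (x', y') → x = x' ∧ y = y') :
    ∃ A B C : E3, dist A B = 2 * √3 / 3 ∧ dist B C = 2 * √3 / 3 ∧ dist C A = 2 * √3 / 3 ∧
      (∀ x ∈ F '' (univ ×ˢ Icc (0 : ℝ) 1),
        Metric.infDist x (convexHull ℝ {A, B, C}) ≤ 3 * √ε) ∧
      ∀ x ∈ convexHull ℝ {A, B, C},
        Metric.infDist x (F '' (univ ×ˢ Icc (0 : ℝ) 1)) ≤ 18 * √ε := by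
  obtain ⟨E, hL, hE, hchord, hnorm⟩ := hF.exists_bends hlam hglue
  set a : ℝ → ℝ := fun x => x - E x / 2 with ha
  set γ : ℝ → E3 := fun x => F (x, 0) with hγdef
  set p : ℝ → E3 := fun x => F (x - E x / 2, 0) with hpdef
  set q : ℝ → E3 := fun x => F (x + E x / 2, 1) with hqdef
  have hpγ : ∀ x, p x = γ (a x) := fun x => rfl
  obtain ⟨s, r, α, β, hsr, hrs, hperp, hβ, hO⟩ := hF.exists_T_pattern hlam hglue hinj
    (p := p) (q := q) (fun x => rfl) (fun x => rfl) hL hE hchord hnorm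
  have hEc : Continuous E := by
    have : LipschitzWith 2 E := LipschitzWith.of_dist_le_mul fun x z => by
      simpa [Real.dist_eq] using hL x z
    exact this.continuous
  have hFc : Continuous F := hF.smooth.continuous
  have hγ : ∀ x y, ‖γ x - γ y‖ ≤ |x - y| := hF.norm_bottom_sub_le
  have haE : ∀ x, a (x + lam) = x + E x / 2 + lam := by
    intro x; simp only [ha, hE]; ring
  have haE2 : ∀ x, a (x + lam + lam) = a x + 2 * lam := by
    intro x; simp only [ha, hE]; ring
  have hqγ : ∀ x, q x = γ (a (x + lam)) := by
    intro x
    rw [haE]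
    simp only [hqdef, hγdef]
    rw [← hglue _ 1 (by simp), sub_self]
  have hper : Function.Periodic γ (2 * lam) := by
    intro x
    have h1 := hglue x 0 (by simp)
    have h2 := hglue (x + lam) 1 (by simp)
    rw [sub_zero] at h1
    rw [sub_self] at h2
    simp only [hγdef]
    rw [← h1, ← h2]
    congr 2; ring
  have hamono : Monotone a := by
    intro x y hxy
    have := (abs_le.1 (hL x y)).1
    rw [abs_of_nonpos (sub_nonpos.2 hxy)] at this
    simp only [ha]
    linarith
  have hpq : p (s + lam) = q s := by rw [hpγ, hqγ]
  have hqp : q (s + lam) = p s := by rw [hpγ, hqγ, haE2, hper]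
  -- an adapted orthonormal frame
  set uT := q s - p s with huT
  set uB := q r - p r with huB
  have hTn : ‖uT‖ = √(1 + E s ^ 2) := hnorm s
  have hBn : ‖uB‖ = √(1 + E r ^ 2) := hnorm r
  have hT1 : 1 ≤ ‖uT‖ := by rw [hTn]; exact Real.one_le_sqrt.2 (by linarith [sq_nonneg (E s)])
  have hB1 : 1 ≤ ‖uB‖ := by rw [hBn]; exact Real.one_le_sqrt.2 (by linarith [sq_nonneg (E r)])
  have hT0 : ‖uT‖ ≠ 0 := by linarith
  have hB0 : ‖uB‖ ≠ 0 := by linarith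
  obtain ⟨e₁, he₁⟩ : ∃ e : E3, e = ‖uT‖⁻¹ • uT := ⟨_, rfl⟩
  obtain ⟨e₂, he₂⟩ : ∃ e : E3, e = -‖uB‖⁻¹ • uB := ⟨_, rfl⟩
  have h₁ : ‖e₁‖ = 1 := by rw [he₁, norm_smul, norm_inv, norm_norm, inv_mul_cancel₀ hT0]
  have h₂ : ‖e₂‖ = 1 := by rw [he₂, norm_smul, norm_neg, norm_inv, norm_norm, inv_mul_cancel₀ hB0]
  have h₁₂ : ⟪e₁, e₂⟫ = 0 := by
    rw [he₁, he₂, inner_smul_left, inner_smul_right, hperp]; simp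
  obtain ⟨c, hc⟩ : ∃ c : ℝ, c = ‖uT‖ / 2 := ⟨_, rfl⟩
  obtain ⟨h, hh⟩ : ∃ h : ℝ, h = β * ‖uB‖ := ⟨_, rfl⟩
  obtain ⟨σ, hσ⟩ : ∃ σ : ℝ, σ = (α - 1 / 2) * ‖uT‖ := ⟨_, rfl⟩
  obtain ⟨M, hM⟩ : ∃ M : E3, M = p s + (1 / 2 : ℝ) • uT := ⟨_, rfl⟩
  have euT : uT = ‖uT‖ • e₁ := by rw [he₁, smul_smul, mul_inv_cancel₀ hT0, one_smul]
  have euB : uB = -(‖uB‖ • e₂) := by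
    rw [he₂, smul_smul, mul_neg, mul_inv_cancel₀ hB0, neg_one_smul, neg_neg]
  have eps : p s = M + (-c) • e₁ := by
    have : c • e₁ = (1 / 2 : ℝ) • uT := by
      rw [hc, euT, norm_smul, h₁]
      norm_num [smul_smul]
      ring_nf
    rw [neg_smul, this, hM]; abel
  have eqs : q s = M + c • e₁ := by
    have h1 : c • e₁ = (1 / 2 : ℝ) • uT := by
      rw [hc, euT, norm_smul, h₁]
      norm_num [smul_smul]
      ring_nf
    rw [h1, hM, huT]; module
  have epr : p r = M + (σ • e₁ + h • e₂) := by
    have h1 : σ • e₁ = (α - 1 / 2) • uT := by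
      conv_rhs => rw [euT]
      rw [hσ, smul_smul]
    have h2 : h • e₂ = -(β • uB) := by
      conv_rhs => rw [euB]
      rw [hh, smul_neg, neg_neg, smul_smul]
    rw [h1, h2, hM]
    have h3 : p r = p s + α • uT - β • uB := by rw [hO]; abel
    rw [h3]; module
  have hnc : ∀ x y : ℝ, ‖x • e₁ + y • e₂‖ ^ 2 = x ^ 2 + y ^ 2 := norm_sq_combo h₁ h₂ h₁₂
  have d1e : γ (a r) - γ (a s) = (σ + c) • e₁ + h • e₂ := by
    rw [← hpγ, ← hpγ, epr, eps]; module
  have d2e : γ (a (s + lam)) - γ (a r) = (c - σ) • e₁ + (-h) • e₂ := by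
    rw [← hqγ, ← hpγ, epr, eqs]; module
  have hend : γ (a s + 2 * lam) = p s := by rw [hper, hpγ]
  have d3e : γ (a s + 2 * lam) - γ (a (s + lam)) = -((2 * c) • e₁) := by
    rw [hend, ← hqγ, eps, eqs]; module
  have m1 : a s ≤ a r := hamono hsr.le
  have m2 : a r ≤ a (s + lam) := hamono hrs.le
  have m3 : a (s + lam) ≤ a s + 2 * lam := by rw [← haE2]; exact hamono (by linarith)
  have hc0 : 0 ≤ c := by rw [hc]; positivity
  have d3n : ‖γ (a s + 2 * lam) - γ (a (s + lam))‖ = 2 * c := by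
    rw [d3e, norm_neg, norm_smul, h₁, mul_one, Real.norm_of_nonneg (by positivity)]
  have l1 := hγ (a r) (a s)
  have l2 := hγ (a (s + lam)) (a r)
  have l3 := hγ (a s + 2 * lam) (a (s + lam))
  rw [abs_of_nonneg (sub_nonneg.2 m1)] at l1
  rw [abs_of_nonneg (sub_nonneg.2 m2)] at l2
  rw [abs_of_nonneg (sub_nonneg.2 m3), d3n] at l3
  have el3 : a s + 2 * lam - a (s + lam) = lam - E s := by
    rw [haE]; simp only [ha]; ring
  obtain ⟨k1, k2, k3, k4, k5⟩ := T_pattern_estimates (t := E s) (c := c) (s := σ) (h := h)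
    hε0 hε hlam hratio hc0
    (by rw [hc, div_pow, hTn, Real.sq_sqrt (by positivity)]; ring)
    (by rw [hh]; nlinarith) (norm_nonneg _) (norm_nonneg _)
    (by rw [d1e, hnc]) (by rw [d2e, hnc]; ring) l1 l2
    (by rw [sub_add_sub_cancel', haE]; simp only [ha]; ring) (by rw [← el3]; exact l3)
  rw [← el3, ← d3n] at k5
  have hε' : √ε ^ 2 = ε := Real.sq_sqrt hε0.le
  have hse0 : 0 ≤ √ε := Real.sqrt_nonneg ε
  have hκ : ∀ x : ℝ, x ≤ 196 / 25 * ε → x ≤ 4 * (7 / 5 * √ε) ^ 2 := by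
    intro x hx; rw [mul_pow, hε']; linarith
  have hκ0 : 0 ≤ 7 / 5 * √ε := by positivity
  have hη : ∀ v : E3, ‖v‖ ^ 2 ≤ 64 / 25 * ε → ‖v‖ ≤ 8 / 5 * √ε := by
    intro v hv
    refine (abs_le_of_sq_le_sq' ?_ (by positivity)).2
    rw [mul_pow, hε']; linarith
  have hsum : 7 / 5 * √ε + 8 / 5 * √ε = 3 * √ε := by ring
  obtain ⟨A, hA⟩ : ∃ A : E3, A = M - (√3 / 3) • e₁ := ⟨_, rfl⟩
  obtain ⟨B, hB⟩ : ∃ B : E3, B = M + (√3 / 3) • e₁ := ⟨_, rfl⟩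
  obtain ⟨C, hC⟩ : ∃ C : E3, C = M + e₂ := ⟨_, rfl⟩
  have nA : ‖γ (a s) - A‖ ≤ 8 / 5 * √ε := by
    refine hη _ ?_
    have e : γ (a s) - A = (-(c - √3 / 3)) • e₁ + (0 : ℝ) • e₂ := by
      rw [← hpγ, eps, hA]; module
    rw [e, hnc]; linarith
  have nB : ‖γ (a (s + lam)) - B‖ ≤ 8 / 5 * √ε := by
    refine hη _ ?_
    have e : γ (a (s + lam)) - B = (c - √3 / 3) • e₁ + (0 : ℝ) • e₂ := by
      rw [← hqγ, eqs, hB]; module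
    rw [e, hnc]; linarith
  have nC : ‖γ (a r) - C‖ ≤ 8 / 5 * √ε := by
    refine hη _ ?_
    have e : γ (a r) - C = σ • e₁ + (h - 1) • e₂ := by
      rw [← hpγ, epr, hC]; module
    rw [e, hnc]; linarith
  have nA' : ‖γ (a s + 2 * lam) - A‖ ≤ 8 / 5 * √ε := by rw [hper]; exact nA
  have arc1 : ∀ x ∈ Icc (a s) (a r), ∃ v ∈ segment ℝ A C, ‖γ x - v‖ ≤ 3 * √ε := by
    rw [← hsum]
    exact fun x hx => arc_near_segment_left hγ m1 hκ0 (hκ _ k3) nA nC hx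
  have arc2 : ∀ x ∈ Icc (a r) (a (s + lam)), ∃ v ∈ segment ℝ C B, ‖γ x - v‖ ≤ 3 * √ε := by
    rw [← hsum]
    exact fun x hx => arc_near_segment_left hγ m2 hκ0 (hκ _ k4) nC nB hx
  have arc3 : ∀ x ∈ Icc (a (s + lam)) (a s + 2 * lam),
      ∃ v ∈ segment ℝ A B, ‖γ x - v‖ ≤ 3 * √ε := by
    rw [← hsum, segment_symm]
    exact fun x hx => arc_near_segment_left hγ m3 hκ0 (hκ _ k5) nB nA' hx
  have hbot : ∀ x, ∃ v ∈ convexHull ℝ {A, B, C}, ‖γ x - v‖ ≤ 3 * √ε := by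
    intro x
    have hsub : ∀ U V : E3, U ∈ ({A, B, C} : Set E3) → V ∈ ({A, B, C} : Set E3) →
        segment ℝ U V ⊆ convexHull ℝ {A, B, C} := fun U V hU hV =>
      (convex_convexHull ℝ _).segment_subset (subset_convexHull ℝ _ hU) (subset_convexHull ℝ _ hV)
    obtain ⟨y, hy, hxy⟩ := hper.exists_mem_Ico (by linarith) x (a s)
    rw [hxy]
    rcases le_total y (a r) with hyr | hyr
    · obtain ⟨v, hv, hv2⟩ := arc1 y ⟨hy.1, hyr⟩
      exact ⟨v, hsub _ _ (by simp) (by simp) hv, hv2⟩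
    rcases le_total y (a (s + lam)) with hyl | hyl
    · obtain ⟨v, hv, hv2⟩ := arc2 y ⟨hyr, hyl⟩
      exact ⟨v, hsub _ _ (by simp) (by simp) hv, hv2⟩
    · obtain ⟨v, hv, hv2⟩ := arc3 y ⟨hyl, hy.2.le⟩
      exact ⟨v, hsub _ _ (by simp) (by simp) hv, hv2⟩
  obtain ⟨D1, D2, D3⟩ := dist_vertices (M := M) h₁ h₂ h₁₂
  refine ⟨A, B, C, by rw [hA, hB, D1], by rw [hB, hC, D2], by rw [hC, hA, D3], ?_, ?_⟩
  · rintro _ ⟨⟨x, y⟩, ⟨-, hy⟩, rfl⟩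
    obtain ⟨z, hz⟩ := exists_bend_through hlam hEc hL hE x hy
    have h5 := hchord z y hy
    rw [hz] at h5
    rw [h5]
    refine infDist_combo_le (convex_convexHull ℝ _) (hbot _) ?_ hy
    obtain ⟨v, hv, hv2⟩ := hbot (a (z + lam))
    exact ⟨v, hv, by rw [← hqγ] at hv2; exact hv2⟩
  · intro z hz
    have hγS : ∀ x, γ x ∈ F '' (univ ×ˢ Icc (0 : ℝ) 1) := fun x => ⟨(x, 0), by simp, rfl⟩
    have hδ : 3 * √ε ≤ 4 / 25 := by
      have : √ε ≤ 4 / 75 := by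
        rw [Real.sqrt_le_left (by norm_num)]; norm_num; linarith
      linarith
    obtain ⟨x, hx, hx2⟩ := triangle_covered h₁ h₂ h₁₂ hA hB hC (P := p) (Q := q)
      (S := F '' (univ ×ˢ Icc (0 : ℝ) 1))
      (by fun_prop) (by fun_prop) (s := s) (s' := s + lam) (by linarith)
      (by positivity) hδ hpq hqp
      (fun x hx => by
        rw [hpγ]
        rcases le_total (a x) (a r) with hxr | hxr
        · obtain ⟨v, hv, hv2⟩ := arc1 (a x) ⟨hamono hx.1, hxr⟩
          exact ⟨v, Or.inl hv, hv2⟩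
        · obtain ⟨v, hv, hv2⟩ := arc2 (a x) ⟨hxr, hamono hx.2⟩
          exact ⟨v, Or.inr hv, hv2⟩)
      (fun x hx => by
        rw [hqγ]
        refine arc3 _ ⟨hamono (by linarith [hx.1]), ?_⟩
        rw [← haE2]
        exact hamono (by linarith [hx.2]))
      (fun x => by
        rw [norm_sub_rev, hnorm]
        exact Real.one_le_sqrt.2 (by linarith [sq_nonneg (E x)]))
      (fun x θ hθ => ⟨_, ⟨mem_univ _, hθ⟩, hchord x θ hθ⟩)
      (fun v hv => by
        obtain ⟨x, hx⟩ := arc_near_segment_right hγ hκ0 (hκ _ k3) nA nC hv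
        exact ⟨γ x, hγS x, by rwa [hsum] at hx⟩)
      (fun v hv => by
        obtain ⟨x, hx⟩ := arc_near_segment_right hγ hκ0 (hκ _ k4) nC nB hv
        exact ⟨γ x, hγS x, by rwa [hsum] at hx⟩)
      (fun v hv => by
        rw [segment_symm] at hv
        obtain ⟨x, hx⟩ := arc_near_segment_right hγ hκ0 (hκ _ k5) nB nA' hv
        exact ⟨γ x, hγS x, by rwa [hsum] at hx⟩) hz
    refine (Metric.infDist_le_dist_of_mem hx).trans ?_
    rw [dist_eq_norm]
    linarith

end PaperMoebius

/-- If `0 < ε < 1/384` and `f` encodes a smooth embedded paper Moebius band of aspect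
ratio `lam < √3 + ε`, with image `Ω = f '' (ℝ × [0,1])`, then there is an equilateral
triangle `▽₀ = convexHull ℝ {A, B, C}` of perimeter `2√3` such that every point of `Ω`
is within `6√ε` of `▽₀` and every point of `▽₀` is within `18√ε` of `Ω`. -/
theorem omega_and_triangle_mutually_close
    (ε lam : ℝ) (hε0 : 0 < ε) (hε : ε < 1 / 384)
    (hlam : 0 < lam)
    (f : ℝ → ℝ → EuclideanSpace ℝ (Fin 3))
    (hsmooth : ContDiff ℝ (⊤ : ℕ∞) (fun p : ℝ × ℝ => f p.1 p.2))
    (hglue : ∀ x : ℝ, ∀ y ∈ Set.Icc (0 : ℝ) 1, f (x + lam) (1 - y) = f x y)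
    (hisom : ∀ p : ℝ × ℝ, p.2 ∈ Set.Icc (0 : ℝ) 1 → ∀ v : ℝ × ℝ,
      ‖fderiv ℝ (fun q : ℝ × ℝ => f q.1 q.2) p v‖ = Real.sqrt (v.1 ^ 2 + v.2 ^ 2))
    (hinj : ∀ x x' y y' : ℝ, x ∈ Set.Ico (0 : ℝ) lam → x' ∈ Set.Ico (0 : ℝ) lam →
      y ∈ Set.Icc (0 : ℝ) 1 → y' ∈ Set.Icc (0 : ℝ) 1 →
      f x y = f x' y' → x = x' ∧ y = y')
    (hratio : lam < Real.sqrt 3 + ε) :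
    ∃ A B C : EuclideanSpace ℝ (Fin 3),
      dist A B = 2 * Real.sqrt 3 / 3 ∧ dist B C = 2 * Real.sqrt 3 / 3 ∧
      dist C A = 2 * Real.sqrt 3 / 3 ∧
      (∀ x ∈ (fun p : ℝ × ℝ => f p.1 p.2) '' (Set.univ ×ˢ Set.Icc (0 : ℝ) 1),
        Metric.infDist x (convexHull ℝ {A, B, C}) ≤ 6 * Real.sqrt ε) ∧
      (∀ x ∈ convexHull ℝ {A, B, C},
        Metric.infDist x
          ((fun p : ℝ × ℝ => f p.1 p.2) '' (Set.univ ×ˢ Set.Icc (0 : ℝ) 1)) ≤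
          18 * Real.sqrt ε) := by
  have hF : PaperMoebius.IsoStrip (fun p : ℝ × ℝ => f p.1 p.2) :=
    ⟨hsmooth, fun p hp v => hisom p hp v⟩
  obtain ⟨A, B, C, hAB, hBC, hCA, hband, htri⟩ :=
    hF.exists_close_triangle hε0 hε hlam hratio hglue hinj
  refine ⟨A, B, C, hAB, hBC, hCA, fun x hx => (hband x hx).trans ?_, htri⟩
  linarith [Real.sqrt_nonneg ε]
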